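/- arXiv:1205.1753 — 3 statements merged into one kernel-verified Lean document; each statement's English description precedes it below -/
import Mathlib

section
/- Let M_0 be a finitely generated W_n(F_q)-module with a σ_0-linear endomorphism Φ_0, put F_0 = Φ_0^d where d = [F_q : F_p], and let M = M_0 ⊗_{W_n(F_q)} W_n(k) with Φ and F the semilinear and linear extensions of Φ_0 and F_0. Then Φ and F are nilpotent on the cokernel M' of the canonical injection M^{Φ=1} ⊗_{Z/p^n} W_n(k) → M. -/
/-- An algebraic closure of the finite field `𝔽_q` with `q = p ^ d` elements. -/
abbrev FqBar (p d : ℕ) [Fact p.Prime] : Type :=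
  AlgebraicClosure (GaloisField p d)

/-- The Frobenius `σ` of the truncated Witt vectors `W_n(R)` of a ring `R` of characteristic
`p`, induced by the `p`-th power map on `R`: it acts coefficientwise by `x ↦ x ^ p`. -/
noncomputable def truncatedWittFrobenius (p n : ℕ) [Fact p.Prime] (R : Type*) [CommRing R] :
    TruncatedWittVector p n R → TruncatedWittVector p n R :=
  fun x => TruncatedWittVector.mk p fun i => x.coeff i ^ p

namespace FrobNilp

section abstract
variable {W M : Type*} [CommRing W] [AddCommGroup M] [Module W M]

theorem iterate_smul (σ : W →+* W) (Φ : M →+ M) (hΦ : ∀ (c : W) (x : M), Φ (c • x) = σ c • Φ x)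
    (i : ℕ) (c : W) (x : M) : Φ^[i] (c • x) = σ^[i] c • Φ^[i] x := by
  induction i generalizing c x with
  | zero => rfl
  | succ i ih => simp only [Function.iterate_succ_apply, hΦ, ih]

theorem iterate_mem_span (σ : W →+* W) (Φ : M →+ M)
    (hΦ : ∀ (c : W) (x : M), Φ (c • x) = σ c • Φ x) (i : ℕ) (x : M)
    (hx : x ∈ Submodule.span W {y : M | Φ y = y}) :
    Φ^[i] x ∈ Submodule.span W {y : M | Φ y = y} := by
  induction i generalizing x with
  | zero => exact hx
  | succ i ih =>
    rw [Function.iterate_succ_apply]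
    apply ih
    induction hx using Submodule.span_induction with
    | mem x h =>
      have h' : Φ x = x := h
      rw [h']; exact Submodule.subset_span h
    | zero => simp
    | add x y _ _ hx hy => rw [map_add]; exact add_mem hx hy
    | smul a x _ hx => rw [hΦ]; exact Submodule.smul_mem _ _ hx

/-- Galois descent by a Vandermonde matrix: a periodic point is in the span of fixed points. -/
theorem periodic_mem_span (σ : W →+* W) (Φ : M →+ M)
    (hΦ : ∀ (c : W) (x : M), Φ (c • x) = σ c • Φ x)
    (N : ℕ) (hN : 0 < N) (ζ : W) (hζ : σ^[N] ζ = ζ)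
    (hdet : IsUnit (Matrix.vandermonde (fun i : Fin N => σ^[(i : ℕ)] ζ)).det)
    (y : M) (hy : Φ^[N] y = y) : y ∈ Submodule.span W {y : M | Φ y = y} := by
  set V := Matrix.vandermonde (fun i : Fin N => σ^[(i : ℕ)] ζ) with hV
  have hfix : ∀ j : Fin N, Φ (∑ i : Fin N, V i j • Φ^[(i : ℕ)] y) =
      ∑ i : Fin N, V i j • Φ^[(i : ℕ)] y := by
    intro j
    let g : ℕ → M := fun i => (σ^[i] ζ) ^ (j : ℕ) • Φ^[i] y
    have h1 : ∑ i : Fin N, V i j • Φ^[(i : ℕ)] y = ∑ i ∈ Finset.range N, g i := by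
      rw [← Fin.sum_univ_eq_sum_range]
      rfl
    have hg : ∀ i, Φ (g i) = g (i + 1) := by
      intro i
      simp only [g, hΦ, map_pow, Function.iterate_succ_apply']
    have h0 : g N = g 0 := by
      simp only [g, hζ, hy, Function.iterate_zero, id]
    rw [h1, map_sum]
    simp only [hg]
    have := Finset.sum_range_succ g N
    rw [Finset.sum_range_succ', h0] at this
    exact add_right_cancel this
  have hinv : V * V⁻¹ = 1 := Matrix.mul_nonsing_inv V hdet
  have key : y = ∑ j : Fin N, V⁻¹ j ⟨0, hN⟩ • ∑ i : Fin N, V i j • Φ^[(i : ℕ)] y := by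
    simp only [Finset.smul_sum]
    rw [Finset.sum_comm]
    have : ∀ i : Fin N, ∑ j : Fin N, V⁻¹ j ⟨0, hN⟩ • V i j • Φ^[(i : ℕ)] y =
        (V * V⁻¹) i ⟨0, hN⟩ • Φ^[(i : ℕ)] y := by
      intro i
      rw [Matrix.mul_apply, Finset.sum_smul]
      refine Finset.sum_congr rfl fun j _ => ?_
      rw [smul_smul, mul_comm]
    simp only [this, hinv, Matrix.one_apply, ite_smul, one_smul, zero_smul]
    simp
  rw [key]
  exact Submodule.sum_mem _ fun j _ => Submodule.smul_mem _ _ (Submodule.subset_span (hfix j))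

theorem orbit_collision (σ : W →+* W) (Φ : M →+ M)
    (hΦ : ∀ (c : W) (x : M), Φ (c • x) = σ c • Φ x)
    (hper : ∀ c : W, ∃ m, 0 < m ∧ σ^[m] c = c)
    (hfin : ∀ m, 0 < m → {c : W | σ^[m] c = c}.Finite)
    (s : Finset M) (hs : Submodule.span W (s : Set M) = ⊤) (x : M) :
    ∃ e N : ℕ, 0 < N ∧ Φ^[N] (Φ^[e] x) = Φ^[e] x := by
  classical
  have hex : ∀ z : M, ∃ f : s → W, ∑ i, f i • (i : M) = z := by
    intro z
    have hz : z ∈ Submodule.span W (Set.range (fun i : s => (i : M))) := by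
      simp [hs]
    exact (Submodule.mem_span_range_iff_exists_fun W).1 hz
  choose b hb using hex
  choose m hm0 hm using hper
  let L : ℕ := (∏ i : s, ∏ j : s, m (b (Φ i) j)) * ∏ i : s, m (b x i)
  have hL0 : 0 < L := Nat.mul_pos
    (Finset.prod_pos fun _ _ => Finset.prod_pos fun _ _ => hm0 _) (Finset.prod_pos fun _ _ => hm0 _)
  have hper' : ∀ c : W, m c ∣ L → (σ ^ L) c = c := by
    intro c hc
    rw [RingHom.coe_pow]
    exact Function.IsPeriodicPt.trans_dvd (hm c) hc
  let A : Subring W := RingHom.eqLocus (σ ^ L) (RingHom.id W)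
  have hA : ∀ c, c ∈ A ↔ (σ ^ L) c = c := fun c => Iff.rfl
  have hAfin : (A : Set W).Finite := by
    refine (hfin L hL0).subset fun c hc => ?_
    have := (hA c).1 hc
    rwa [RingHom.coe_pow] at this
  have hσA : ∀ c ∈ A, σ c ∈ A := by
    intro c hc
    rw [hA] at hc ⊢
    rw [RingHom.coe_pow] at hc ⊢
    rw [← Function.iterate_succ_apply, Function.iterate_succ_apply', hc]
  have hbA : ∀ i j : s, b (Φ i) j ∈ A := fun i j => hper' _ <| Dvd.dvd.mul_right
    ((Finset.dvd_prod_of_mem (fun j : s => m (b (Φ i) j)) (Finset.mem_univ j)).trans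
      (Finset.dvd_prod_of_mem (fun i : s => ∏ j : s, m (b (Φ i) j)) (Finset.mem_univ i))) _
  have hxA : ∀ i : s, b x i ∈ A := fun i => hper' _ <| Dvd.dvd.mul_left
    (Finset.dvd_prod_of_mem (fun i : s => m (b x i)) (Finset.mem_univ i)) _
  have : Finite A := hAfin
  let T : Set M := Set.range (fun f : s → A => ∑ i, (f i : W) • (i : M))
  have hT : T.Finite := Set.finite_range _
  have hΦT : ∀ z ∈ T, Φ z ∈ T := by
    rintro _ ⟨f, rfl⟩
    refine ⟨fun j => ∑ i, ⟨σ (f i), hσA _ (f i).2⟩ * ⟨b (Φ i) j, hbA i j⟩, ?_⟩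
    simp only [map_sum, hΦ]
    have : ∀ i : s, σ (f i) • Φ (i : M) = ∑ j : s, (σ (f i) * b (Φ i) j) • (j : M) := by
      intro i
      conv_lhs => rw [← hb (Φ i)]
      rw [Finset.smul_sum]
      simp only [smul_smul]
    simp only [this]
    rw [Finset.sum_comm]
    simp [Finset.sum_smul]
  have hxT : x ∈ T := ⟨fun i => ⟨b x i, hxA i⟩, hb x⟩
  have horb : ∀ e, Φ^[e] x ∈ T := by
    intro e
    induction e with
    | zero => exact hxT
    | succ e ih => rw [Function.iterate_succ_apply']; exact hΦT _ ih
  have : Finite T := hT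
  obtain ⟨i, j, hij, h⟩ := Finite.exists_ne_map_eq_of_infinite (fun e : ℕ => (⟨_, horb e⟩ : T))
  have h' : Φ^[i] x = Φ^[j] x := congrArg Subtype.val h
  rcases lt_or_gt_of_ne hij with hlt | hlt
  · refine ⟨i, j - i, by omega, ?_⟩
    rw [← Function.iterate_add_apply, Nat.sub_add_cancel hlt.le, h']
  · refine ⟨j, i - j, by omega, ?_⟩
    rw [← Function.iterate_add_apply, Nat.sub_add_cancel hlt.le, h']

end abstract

section witt
variable (p d n : ℕ) [Fact p.Prime]

theorem frob_truncate (x : WittVector p (FqBar p d)) :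
    truncatedWittFrobenius p n (FqBar p d) (WittVector.truncate n x) =
      WittVector.truncate n (WittVector.frobenius x) := by
  ext i
  simp [truncatedWittFrobenius, WittVector.coeff_truncate, WittVector.coeff_frobenius_charP]

/-- The truncated Frobenius as a ring homomorphism. -/
noncomputable def frobHom :
    TruncatedWittVector p n (FqBar p d) →+* TruncatedWittVector p n (FqBar p d) where
  toFun := truncatedWittFrobenius p n (FqBar p d)
  map_one' := by
    rw [← map_one (WittVector.truncate n), frob_truncate, map_one]
  map_zero' := by
    rw [← map_zero (WittVector.truncate n), frob_truncate, map_zero]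
  map_mul' x y := by
    obtain ⟨x, rfl⟩ := WittVector.truncate_surjective p n _ x
    obtain ⟨y, rfl⟩ := WittVector.truncate_surjective p n _ y
    rw [← map_mul, frob_truncate, frob_truncate, frob_truncate, map_mul, map_mul]
  map_add' x y := by
    obtain ⟨x, rfl⟩ := WittVector.truncate_surjective p n _ x
    obtain ⟨y, rfl⟩ := WittVector.truncate_surjective p n _ y
    rw [← map_add, frob_truncate, frob_truncate, frob_truncate, map_add, map_add]

theorem coeff_iterate (m : ℕ) (c : TruncatedWittVector p n (FqBar p d)) (i : Fin n) :
    ((frobHom p d n)^[m] c).coeff i = c.coeff i ^ p ^ m := by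
  induction m with
  | zero => simp
  | succ m ih =>
    rw [Function.iterate_succ_apply']
    change ((TruncatedWittVector.mk p fun i => ((frobHom p d n)^[m] c).coeff i ^ p)).coeff i = _
    rw [TruncatedWittVector.coeff_mk, ih, ← pow_mul, pow_succ]

theorem field_periodic (a : FqBar p d) : ∃ m, 0 < m ∧ a ^ p ^ m = a := by
  let K := GaloisField p d
  have ha : IsIntegral K a := Algebra.IsIntegral.isIntegral a
  have : FiniteDimensional K (IntermediateField.adjoin K {a}) :=
    IntermediateField.adjoin.finiteDimensional ha
  have : Finite (IntermediateField.adjoin K {a}) := Module.finite_of_finite K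
  have := Fintype.ofFinite (IntermediateField.adjoin K {a})
  obtain ⟨m, hm, hc⟩ := FiniteField.card (IntermediateField.adjoin K {a}) p
  refine ⟨m, m.2, ?_⟩
  have := FiniteField.pow_card (⟨a, IntermediateField.mem_adjoin_simple_self K a⟩ :
    IntermediateField.adjoin K {a})
  rw [hc] at this
  exact congrArg Subtype.val this

theorem witt_periodic (c : TruncatedWittVector p n (FqBar p d)) :
    ∃ m, 0 < m ∧ (frobHom p d n)^[m] c = c := by
  choose m hm0 hm using field_periodic p d
  refine ⟨∏ i, m (c.coeff i), Finset.prod_pos fun _ _ => hm0 _, ?_⟩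
  ext i
  rw [coeff_iterate]
  obtain ⟨r, hr⟩ := Finset.dvd_prod_of_mem (fun i => m (c.coeff i)) (Finset.mem_univ i)
  rw [hr]
  clear hr
  induction r with
  | zero => simp
  | succ r ih => rw [mul_add, pow_add, pow_mul, ih, mul_one, hm]

theorem witt_finite (m : ℕ) (hm : 0 < m) :
    {c : TruncatedWittVector p n (FqBar p d) | (frobHom p d n)^[m] c = c}.Finite := by
  have hp : 1 < p ^ m := Nat.one_lt_pow hm.ne' (Fact.out : p.Prime).one_lt
  have h1 : {a : FqBar p d | a ^ p ^ m = a}.Finite := by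
    have hne : (Polynomial.X ^ p ^ m - Polynomial.X : Polynomial (FqBar p d)) ≠ 0 :=
      FiniteField.X_pow_card_sub_X_ne_zero _ hp
    refine (Polynomial.finite_setOfPred_isRoot hne).subset fun a ha => ?_
    have ha' : a ^ p ^ m = a := ha
    simp [Polynomial.IsRoot, ha']
  have h2 := Set.Finite.pi' (fun _ : Fin n => h1)
  refine Set.Finite.of_injOn (f := fun c : TruncatedWittVector p n (FqBar p d) =>
    fun i => c.coeff i) (t := {f : Fin n → FqBar p d | ∀ i, f i ∈ {a : FqBar p d | a ^ p ^ m = a}})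
    ?_ (fun c _ c' _ h => ?_) h2
  · intro c hc i
    have hc' : (frobHom p d n)^[m] c = c := hc
    change c.coeff i ^ p ^ m = c.coeff i
    rw [← coeff_iterate, hc']
  · exact TruncatedWittVector.ext fun i => congrFun h i

theorem exists_zeta (N : ℕ) (hN : 0 < N) : ∃ ζ : TruncatedWittVector p n (FqBar p d),
    (frobHom p d n)^[N] ζ = ζ ∧
    IsUnit (Matrix.vandermonde (fun i : Fin N => (frobHom p d n)^[(i : ℕ)] ζ)).det := by
  have hp1 : 1 < p := (Fact.out : p.Prime).one_lt
  have hpN : 1 < p ^ N := Nat.one_lt_pow hN.ne' hp1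
  have : NeZero ((p ^ N - 1 : ℕ) : FqBar p d) := by
    constructor
    rw [Nat.cast_sub hpN.le, Nat.cast_pow, CharP.cast_eq_zero, zero_pow hN.ne']
    simp
  obtain ⟨z, hz⟩ := HasEnoughRootsOfUnity.exists_primitiveRoot (FqBar p d) (p ^ N - 1)
  have hzN : z ^ p ^ N = z := by
    have := hz.pow_eq_one
    calc z ^ p ^ N = z ^ (p ^ N - 1 + 1) := by rw [Nat.sub_add_cancel hpN.le]
      _ = z := by rw [pow_succ, this, one_mul]
  have hinj : ∀ i j : ℕ, i < j → j < N → z ^ p ^ j - z ^ p ^ i ≠ 0 := by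
    intro i j hij hj h
    have h' := sub_eq_zero.1 h
    have e1 : p ^ i < p ^ j := Nat.pow_lt_pow_right hp1 hij
    have e2 : p ^ j < p ^ N := Nat.pow_lt_pow_right hp1 hj
    have e0 : 0 < p ^ i := Nat.pow_pos (by omega)
    have hdvd : p ^ N - 1 ∣ p ^ j - p ^ i := by
      rw [← hz.pow_eq_one_iff_dvd]
      have hz0 : z ≠ 0 := hz.ne_zero (by omega)
      have : z ^ (p ^ j - p ^ i) * z ^ p ^ i = 1 * z ^ p ^ i := by
        rw [← pow_add, Nat.sub_add_cancel e1.le, h', one_mul]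
      exact mul_right_cancel₀ (pow_ne_zero _ hz0) this
    have := Nat.le_of_dvd (by omega) hdvd
    omega
  have hit : ∀ i : ℕ, (frobHom p d n)^[i] (WittVector.truncate n (WittVector.teichmuller p z)) =
      WittVector.truncate n (WittVector.teichmuller p (z ^ p ^ i)) := by
    intro i
    induction i with
    | zero => simp
    | succ i ih =>
      rw [Function.iterate_succ_apply', ih]
      refine (frob_truncate p d n _).trans ?_
      rw [WittVector.frobenius_eq_map_frobenius, WittVector.map_teichmuller, frobenius_def,
        ← pow_mul, pow_succ]
  refine ⟨WittVector.truncate n (WittVector.teichmuller p z), ?_, ?_⟩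
  · rw [hit, hzN]
  · rw [Matrix.det_vandermonde]
    simp only [hit, ← map_sub]
    refine IsUnit.prod_iff.2 fun i _ => IsUnit.prod_iff.2 fun j hj => IsUnit.map _ ?_
    apply WittVector.isUnit_of_coeff_zero_ne_zero
    have : (WittVector.teichmuller p (z ^ p ^ (j : ℕ)) -
        WittVector.teichmuller p (z ^ p ^ (i : ℕ))).coeff 0 = z ^ p ^ (j : ℕ) - z ^ p ^ (i : ℕ) := by
      refine (map_sub (WittVector.constantCoeff (p := p) (R := FqBar p d)) _ _).trans ?_
      rfl
    rw [this]
    exact hinj _ _ (Fin.lt_def.1 (Finset.mem_Ioi.1 hj)) j.2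

end witt

end FrobNilp

/-- Let `M₀` be a finitely generated `W_n(𝔽_q)`-module with a `σ₀`-linear
endomorphism `Φ₀`, put `F₀ = Φ₀^d` where `d = [𝔽_q : 𝔽_p]`, and let `M = M₀ ⊗_{W_n(𝔽_q)} W_n(k)`
with `Φ` and `F` the semilinear and linear extensions of `Φ₀` and `F₀`.  Then `Φ` and `F` are
nilpotent on the cokernel `M'` of the canonical injection `M^{Φ=1} ⊗_{ℤ/pⁿ} W_n(k) → M`.

The `𝔽_q`-structure of `M` is encoded by the subgroup `M₀ ⊆ M` of elements defined over
`W_n(𝔽_q)`: it generates `M` over `W_n(k)`, is stable under `Φ` and under scalars fixed by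
`σ^d`, and on it `F` coincides with `Φ^d`.  The image of `M^{Φ=1} ⊗ W_n(k) → M` is the
`W_n(k)`-span of the fixed points of `Φ`, so nilpotence on the cokernel means that some iterate
of `Φ` (resp. of `F`) maps `M` into that span. -/
theorem frobenius_nilpotent_on_cokernel
    (p d n : ℕ) [Fact p.Prime] (hd : d ≠ 0)
    (M : Type*) [AddCommGroup M] [Module (TruncatedWittVector p n (FqBar p d)) M]
    [Module.Finite (TruncatedWittVector p n (FqBar p d)) M]
    (M0 : AddSubgroup M)
    (hspan : Submodule.span (TruncatedWittVector p n (FqBar p d)) (M0 : Set M) = ⊤)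
    (Φ : M →+ M)
    (hΦ : ∀ (c : TruncatedWittVector p n (FqBar p d)) (x : M),
      Φ (c • x) = truncatedWittFrobenius p n (FqBar p d) c • Φ x)
    (hΦ0 : ∀ x ∈ M0, Φ x ∈ M0)
    (hM0smul : ∀ c : TruncatedWittVector p n (FqBar p d),
      (truncatedWittFrobenius p n (FqBar p d))^[d] c = c → ∀ x ∈ M0, c • x ∈ M0)
    (F : M →ₗ[TruncatedWittVector p n (FqBar p d)] M)
    (hF0 : ∀ x ∈ M0, F x = (⇑Φ)^[d] x) :
    ∃ e : ℕ, ∀ x : M,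
      (⇑Φ)^[e] x ∈ Submodule.span (TruncatedWittVector p n (FqBar p d)) {y : M | Φ y = y} ∧
      (F ^ e) x ∈ Submodule.span (TruncatedWittVector p n (FqBar p d)) {y : M | Φ y = y} := by
  classical
  have hΦ' : ∀ (c : TruncatedWittVector p n (FqBar p d)) (x : M),
      Φ (c • x) = FrobNilp.frobHom p d n c • Φ x := hΦ
  have hfg : (Submodule.span (TruncatedWittVector p n (FqBar p d)) (M0 : Set M)).FG := by
    rw [hspan]; exact Module.Finite.fg_top
  obtain ⟨s, hsM0, hs⟩ := (Submodule.fg_span_iff_fg_span_finset_subset _).1 hfg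
  rw [hspan] at hs
  have h1 : ∀ x : M, ∃ e : ℕ, (⇑Φ)^[e] x ∈
      Submodule.span (TruncatedWittVector p n (FqBar p d)) {y : M | Φ y = y} := by
    intro x
    obtain ⟨e, N, hN, h⟩ := FrobNilp.orbit_collision _ Φ hΦ' (FrobNilp.witt_periodic p d n)
      (FrobNilp.witt_finite p d n) s hs.symm x
    obtain ⟨ζ, hζ, hdet⟩ := FrobNilp.exists_zeta p d n N hN
    exact ⟨e, FrobNilp.periodic_mem_span _ Φ hΦ' N hN ζ hζ hdet _ h⟩
  choose ε hε using h1
  have h2 : ∀ e, ∀ x ∈ s, s.sup ε ≤ e → (⇑Φ)^[e] x ∈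
      Submodule.span (TruncatedWittVector p n (FqBar p d)) {y : M | Φ y = y} := by
    intro e x hx he
    have hle : ε x ≤ e := (Finset.le_sup hx).trans he
    rw [← Nat.sub_add_cancel hle, Function.iterate_add_apply]
    exact FrobNilp.iterate_mem_span _ Φ hΦ' _ _ (hε x)
  refine ⟨s.sup ε, fun x => ?_⟩
  have hx : x ∈ Submodule.span (TruncatedWittVector p n (FqBar p d)) (s : Set M) := by
    rw [← hs]; trivial
  induction hx using Submodule.span_induction with
  | mem x h =>
    refine ⟨h2 _ x h le_rfl, ?_⟩
    have hF : ∀ e, ∀ x ∈ M0, (F ^ e) x = (⇑Φ)^[d * e] x := by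
      intro e
      induction e with
      | zero => simp
      | succ e ih =>
        intro x hx
        have hmem : ∀ i, (⇑Φ)^[i] x ∈ M0 := by
          intro i
          induction i with
          | zero => exact hx
          | succ i ih => rw [Function.iterate_succ_apply']; exact hΦ0 _ ih
        rw [pow_succ, Module.End.mul_apply, hF0 x hx, ih _ (hmem d),
          ← Function.iterate_add_apply, mul_add, mul_one]
    rw [hF _ x (hsM0 h)]
    exact h2 _ x h (Nat.le_mul_of_pos_left _ (Nat.pos_of_ne_zero hd))
  | zero =>
    rw [iterate_map_zero, map_zero]
    exact ⟨zero_mem _, zero_mem _⟩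
  | add x y _ _ hx hy =>
    rw [iterate_map_add, map_add]
    exact ⟨add_mem hx.1 hy.1, add_mem hx.2 hy.2⟩
  | smul a x _ hx =>
    rw [FrobNilp.iterate_smul _ Φ hΦ', map_smul]
    exact ⟨Submodule.smul_mem _ _ hx.1, Submodule.smul_mem _ _ hx.2⟩
end

section
/- In the setting above, assume in addition that M is free over W_n(k) and M^{Φ=1} is free over Z/p^n. Then there exists an integer N ≥ 1 such that for every W_n(k)-linear endomorphism φ of M that is defined over W_n(F_q) and commutes with Φ, and every m ≥ N, one has Tr(φ ∘ F^m | M^{Φ=1}) = Tr(φ ∘ F^m | M), where the first trace is in Z/p^n and the second in W_n(k), compared via the inclusion Z/p^n → W_n(k). -/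
/-- The subgroup of fixed points of an additive endomorphism `Φ` (i.e. `M^{Φ=1}`). -/
def AddMonoidHom.fixedSubgroup {M : Type*} [AddCommGroup M] (Φ : M →+ M) : AddSubgroup M where
  carrier := {x | Φ x = x}
  zero_mem' := map_zero Φ
  add_mem' := fun {a b} ha hb => by
    simp only [Set.mem_setOf_eq] at *; rw [map_add, ha, hb]
  neg_mem' := fun {a} ha => by
    simp only [Set.mem_setOf_eq] at *; rw [map_neg, ha]

/-- `p ^ n = 0` in the length-`n` truncated Witt vectors of a ring of characteristic `p`. -/
lemma TruncatedWittVector.p_pow_natCast_eq_zero (p n : ℕ) [hp : Fact p.Prime]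
    (R : Type*) [CommRing R] [CharP R p] :
    ((p ^ n : ℕ) : TruncatedWittVector p n R) = 0 := by
  push_cast
  have h : (p : TruncatedWittVector p n R) ^ n =
      WittVector.truncate n ((p : WittVector p R) ^ n) := by
    rw [RingHom.map_pow, map_natCast]
  rw [h]
  apply TruncatedWittVector.ext
  intro i
  rw [WittVector.coeff_truncate, TruncatedWittVector.coeff_zero,
    WittVector.coeff_p_pow_eq_zero]
  exact i.2.ne


/-- The `ℤ/k`-module structure on a `k`-torsion fixed-point subgroup. -/
def AddMonoidHom.fixedSubgroupZModModule (k : ℕ) {M : Type*} [AddCommGroup M] (Φ : M →+ M)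
    (h : ∀ x : Φ.fixedSubgroup, k • x = 0) : Module (ZMod k) Φ.fixedSubgroup :=
  AddCommGroup.zmodModule h


section Abs
set_option linter.unusedSectionVars false
variable {W k : Type*} [CommRing W] [Field k] [IsAlgClosed k] {p n : ℕ} [hp : Fact p.Prime] [CharP k p]

open Polynomial in
/-- recursive polynomial -/
noncomputable def langPoly (p : ℕ) (a : ℕ → k) : ℕ → k[X]
  | 0 => C (a 0) * X ^ p
  | i + 1 => langPoly p a i ^ p + C (a (i+1)) * X ^ p

/-- recursive coefficients -/
def langCoeff (σ : W →+* W) (a : ℕ → W) (t : W) : ℕ → W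
  | 0 => a 0 * σ t
  | i + 1 => σ (langCoeff σ a t i) + a (i+1) * σ t

open Polynomial in
lemma langPoly_dvd (a : ℕ → k) (i : ℕ) : X ^ 2 ∣ langPoly p a i := by
  have h2 : (X : k[X]) ^ 2 ∣ X ^ p := pow_dvd_pow _ hp.out.two_le
  induction i with
  | zero => exact h2.mul_left _
  | succ i ih => exact dvd_add (dvd_pow ih hp.out.ne_zero) (h2.mul_left _)

open Polynomial in
lemma langPoly_eq_zero (a : ℕ → k) (i : ℕ) (h : langPoly p a i = 0) : ∀ j ≤ i, a j = 0 := by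
  induction i with
  | zero =>
    intro j hj
    obtain rfl : j = 0 := by omega
    simpa [langPoly] using h
  | succ i ih =>
    have hd : (X : k[X]) ^ (2 * p) ∣ langPoly p a i ^ p := by
      rw [pow_mul]; exact pow_dvd_pow_of_dvd (langPoly_dvd a i) p
    have hc : a (i+1) = 0 := by
      have h1 := congrArg (fun q => coeff q p) h
      obtain ⟨r, hr⟩ := hd
      have hlt : ¬ (2 * p ≤ p) := by have := hp.out.pos; omega
      simp only [langPoly, hr, coeff_add, coeff_X_pow_mul', coeff_C_mul, coeff_X_pow, if_neg hlt] at h1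
      simpa using h1
    have h0 : langPoly p a i = 0 := by
      simp only [langPoly, hc] at h
      simp at h
      exact h.1
    intro j hj
    rcases Nat.lt_or_ge i j with h' | h'
    · obtain rfl : j = i + 1 := by omega
      exact hc
    · exact ih h0 j h'

open Polynomial in
lemma langPoly_root (a : ℕ → k) (i j : ℕ) (hj : j ≤ i) (ha : a j ≠ 0) :
    ∃ t : k, t ≠ 0 ∧ (langPoly p a i).eval t = t := by
  obtain ⟨r, hr⟩ := langPoly_dvd (p := p) a i
  have hr0 : r ≠ 0 := by
    rintro rfl
    exact ha (langPoly_eq_zero a i (by simpa using hr) j hj)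
  obtain ⟨t, ht⟩ := IsAlgClosed.exists_root (X * r - C 1) (by
    rw [degree_sub_C]
    · rw [degree_mul, degree_X, degree_eq_natDegree hr0]
      norm_cast
      omega
    · rw [degree_mul, degree_X, degree_eq_natDegree hr0]
      norm_cast
      omega)
  have ht' : t * r.eval t = 1 := by
    have : t * r.eval t - 1 = 0 := by simpa [IsRoot] using ht
    linear_combination this
  refine ⟨t, ?_, ?_⟩
  · rintro rfl
    simp at ht'
  · rw [hr]
    simp only [eval_mul, eval_pow, eval_X]
    linear_combination t * ht'

open Polynomial in
lemma langCoeff_eval (π : W →+* k) (σ : W →+* W) (hσ : ∀ c, π (σ c) = π c ^ p) (a : ℕ → W) (t : W) (i : ℕ) :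
    π (langCoeff σ a t i) = (langPoly p (fun j => π (a j)) i).eval (π t) := by
  induction i with
  | zero => simp [langCoeff, langPoly, hσ]
  | succ i ih => simp [langCoeff, langPoly, hσ, ih]

lemma exists_fixed (π : W →+* k) (hπ : Function.Surjective π) (σ : W →+* W)
    (hσ : ∀ c, π (σ c) = π c ^ p) [IsNoetherianRing W]
    {Q : Type*} [AddCommGroup Q] [Module W Q] [Module.Finite W Q] (Φ : Q →ₛₗ[σ] Q)
    (x : ℕ → Q) (hx : ∀ i, Φ (x i) = x (i+1)) (hx0 : ∀ i, x i ≠ 0)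
    (hk : ∀ c, π c = 0 → ∀ i, c • x i = 0) : ∃ v, v ≠ 0 ∧ Φ v = v := by
  classical
  have hex : ∃ m, x m ∈ Submodule.span W (x '' (Finset.range m : Set ℕ)) := by
    let f : ℕ →o Submodule W Q := ⟨fun m => Submodule.span W (x '' (Finset.range m : Set ℕ)), by
      intro m m' h
      apply Submodule.span_mono
      apply Set.image_mono
      exact_mod_cast Finset.range_mono h⟩
    obtain ⟨m, hm⟩ := monotone_stabilizes_iff_noetherian.mpr (inferInstance : IsNoetherian W Q) f
    refine ⟨m, ?_⟩
    have := hm (m+1) (Nat.le_succ m)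
    change x m ∈ f m
    rw [this]
    exact Submodule.subset_span ⟨m, by simp, rfl⟩
  let m := Nat.find hex
  have hm := Nat.find_spec hex
  have hmin : ∀ j < m, _ := fun j hj => Nat.find_min hex hj
  change x m ∈ Submodule.span W (x '' (Finset.range m : Set ℕ)) at hm
  clear_value m
  have hm0 : m ≠ 0 := by
    rintro rfl
    simp at hm
    exact hx0 _ hm
  obtain ⟨l, rfl⟩ := Nat.exists_eq_succ_of_ne_zero hm0
  obtain ⟨a, ha⟩ : ∃ a : ℕ → W, ∑ i ∈ Finset.range (l+1), a i • x i = x (l+1) := by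
    obtain ⟨c, hc⟩ := (Submodule.mem_span_image_finset_iff_exists_fun W).mp hm
    refine ⟨fun i => if h : i ∈ Finset.range (l+1) then c ⟨i, h⟩ else 0, ?_⟩
    rw [← Finset.sum_coe_sort, ← hc]
    refine Finset.sum_congr rfl fun i _ => ?_
    simp only [dif_pos i.2]
  obtain ⟨j, hj, haj⟩ : ∃ j ≤ l, π (a j) ≠ 0 := by
    by_contra! hcon
    apply hx0 (l+1)
    rw [← ha]
    refine Finset.sum_eq_zero fun i hi => hk _ (hcon i ?_) _
    have := Finset.mem_range.mp hi
    omega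
  obtain ⟨t', ht0, ht⟩ := langPoly_root (p := p) (fun j => π (a j)) l j hj haj
  obtain ⟨t, rfl⟩ := hπ t'
  rw [← langCoeff_eval π σ hσ] at ht
  set b := langCoeff σ a t with hb
  refine ⟨∑ i ∈ Finset.range (l+1), b i • x i, ?_, ?_⟩
  · intro h0
    obtain ⟨u, hu⟩ := hπ (π t)⁻¹
    have h1 : x l = (u * b l) • x l := by
      have : (1 - u * b l) • x l = 0 := hk _ (by simp [hu, ht, ht0]) l
      rw [sub_smul, one_smul, sub_eq_zero] at this
      exact this
    apply hmin l (Nat.lt_succ_self l)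
    rw [Finset.sum_range_succ] at h0
    have h2 : b l • x l = - ∑ i ∈ Finset.range l, b i • x i := by
      rw [eq_neg_iff_add_eq_zero, add_comm]; exact h0
    rw [h1, mul_smul, h2]
    refine Submodule.smul_mem _ _ (Submodule.neg_mem _ (Submodule.sum_mem _ fun i hi => ?_))
    exact Submodule.smul_mem _ _ (Submodule.subset_span ⟨i, by simpa using hi, rfl⟩)
  · rw [map_sum]
    simp only [LinearMap.map_smulₛₗ, hx]
    rw [Finset.sum_range_succ]
    have h1 : σ (b l) • x (l+1) = σ t • x (l+1) := by
      have : (σ (b l) - σ t) • x (l+1) = 0 := hk _ (by simp [hσ, ht]) _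
      rw [sub_smul, sub_eq_zero] at this
      exact this
    rw [h1, ← ha, Finset.smul_sum, Finset.sum_range_succ', Finset.sum_range_succ' _ l, ← add_assoc,
      ← Finset.sum_add_distrib]
    congr 1
    · refine Finset.sum_congr rfl fun i _ => ?_
      simp only [hb, langCoeff, smul_smul, ← add_smul]
      congr 1; ring
    · simp only [hb, langCoeff, smul_smul]
      congr 1; ring

lemma nilp_of_no_fixed (π : W →+* k) (hπ : Function.Surjective π) (σ : W →+* W)
    (hσ : ∀ c, π (σ c) = π c ^ p) [IsNoetherianRing W]
    (hker : ∀ c, π c = 0 → (p : W) ∣ c) (hpn : (p : W) ^ n = 0)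
    {Q : Type*} [AddCommGroup Q] [Module W Q] [Module.Finite W Q] (Φ : Q →ₛₗ[σ] Q)
    (hno : ∀ v, Φ v = v → v = 0) (x : Q) : ∃ j, Φ^[j] x = 0 := by
  -- claim by descending on power of p
  have key : ∀ i : ℕ, ∃ j, Φ^[j] ((p : W) ^ (n - i) • x) = 0 := by
    intro i
    induction i with
    | zero => exact ⟨0, by simp [hpn]⟩
    | succ i ih =>
      by_cases hi : n ≤ i
      · have : n - (i+1) = n - i := by omega
        rwa [this]
      obtain ⟨j, hj⟩ := ih
      by_contra! hcon
      set y := (p : W) ^ (n - (i+1)) • x with hy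
      have hpy : (p : W) • y = (p : W) ^ (n - i) • x := by
        rw [hy, smul_smul, ← pow_succ']
        congr 2; omega
      have hcomm : ∀ (j : ℕ) (z : Q), Φ^[j] ((p : W) • z) = (p : W) • Φ^[j] z := by
        intro j
        induction j with
        | zero => simp
        | succ j ih => intro z; simp [Function.iterate_succ_apply', ih, LinearMap.map_smulₛₗ]
      obtain ⟨v, hv0, hv⟩ := exists_fixed π hπ σ hσ Φ (fun l => Φ^[l + j] y)
        (fun l => by rw [← Function.iterate_succ_apply' (⇑Φ)]; congr 2; omega) (fun l => hcon _) (by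
          intro c hc l
          obtain ⟨e, rfl⟩ := hker c hc
          rw [mul_comm, mul_smul, ← hcomm, hpy, Function.iterate_add_apply, hj]
          clear * -
          have : Φ^[l] 0 = 0 := Function.iterate_fixed (map_zero Φ) l
          rw [this, smul_zero])
      exact hv0 (hno v hv)
  simpa using key n

lemma artin_schreier (π : W →+* k) (hπ : Function.Surjective π) (σ : W →+* W)
    (hσ : ∀ c, π (σ c) = π c ^ p)
    (hker : ∀ c, π c = 0 → (p : W) ∣ c) (hpn : (p : W) ^ n = 0) (c : W) : ∃ x, σ x - x = c := by
  have key : ∀ j : ℕ, ∃ x, (p : W) ^ j ∣ σ x - x - c := by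
    intro j
    induction j with
    | zero => exact ⟨0, by simp⟩
    | succ j ih =>
      obtain ⟨x, e, he⟩ := ih
      have h1 : (1 : WithBot ℕ) < (p : WithBot ℕ) := by exact_mod_cast hp.out.one_lt
      have hdeg : (Polynomial.X ^ p - Polynomial.X + Polynomial.C (π e) : Polynomial k).degree = p := by
        rw [Polynomial.degree_add_C]
        · rw [Polynomial.degree_sub_eq_left_of_degree_lt] <;> simp [h1]
        · rw [Polynomial.degree_sub_eq_left_of_degree_lt] <;> simp [h1, hp.out.pos]
      obtain ⟨t, ht⟩ := IsAlgClosed.exists_root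
        (Polynomial.X ^ p - Polynomial.X + Polynomial.C (π e) : Polynomial k) (by
          rw [hdeg]; exact_mod_cast hp.out.ne_zero)
      obtain ⟨y, rfl⟩ := hπ t
      obtain ⟨z, hz⟩ := hker (σ y - y + e) (by simpa [hσ, Polynomial.IsRoot] using ht)
      refine ⟨x + (p : W) ^ j * y, z, ?_⟩
      simp only [map_add, map_mul, map_pow, map_natCast, pow_succ]
      linear_combination he + (p : W) ^ j * hz
  obtain ⟨x, hx⟩ := key n
  rw [hpn, zero_dvd_iff, sub_eq_zero] at hx
  exact ⟨x, hx⟩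

lemma isUnit_of_residue (π : W →+* k) (hπ : Function.Surjective π)
    (hker : ∀ c, π c = 0 → (p : W) ∣ c) (hpn : (p : W) ^ n = 0) (c : W) (hc : π c ≠ 0) :
    IsUnit c := by
  obtain ⟨u, hu⟩ := hπ (π c)⁻¹
  obtain ⟨z, hz⟩ := hker (c * u - 1) (by simp [hu, hc])
  have : IsNilpotent (c * u - 1) := ⟨n, by rw [hz, mul_pow, hpn, zero_mul]⟩
  have h2 := this.isUnit_add_one
  rw [sub_add_cancel] at h2
  exact isUnit_of_mul_isUnit_left h2

lemma eq_pow_mul_unit (π : W →+* k) (hπ : Function.Surjective π)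
    (hker : ∀ c, π c = 0 → (p : W) ∣ c) (hpn : (p : W) ^ n = 0) (c : W) (hc : c ≠ 0) :
    ∃ j e, IsUnit e ∧ c = (p : W) ^ j * e := by
  by_contra! hcon
  have key : ∀ j : ℕ, (p : W) ^ j ∣ c := by
    intro j
    induction j with
    | zero => simp
    | succ j ih =>
      obtain ⟨e, he⟩ := ih
      by_cases h : π e = 0
      · obtain ⟨z, rfl⟩ := hker e h
        exact ⟨z, by rw [he]; ring⟩
      · exact absurd he (hcon j e (isUnit_of_residue π hπ hker hpn e h))
  have := key n
  rw [hpn, zero_dvd_iff] at this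
  exact hc this

lemma int_of_fixed (π : W →+* k) (hπ : Function.Surjective π) (σ : W →+* W)
    (hσ : ∀ c, π (σ c) = π c ^ p)
    (hker : ∀ c, π c = 0 → (p : W) ∣ c) (hpn : (p : W) ^ n = 0) (hpn' : ∀ j < n, (p : W) ^ j ≠ 0)
    (c : W) (hc : σ c = c) : ∃ z : ℤ, (z : W) = c := by
  have key : ∀ j : ℕ, ∃ z : ℤ, (p : W) ^ j ∣ c - z := by
    intro j
    induction j with
    | zero => exact ⟨0, by simp⟩
    | succ j ih =>
      obtain ⟨z, e, he⟩ := ih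
      by_cases hj : j < n
      · have h1 : (p : W) ^ j * (σ e - e) = 0 := by
          have := congrArg σ he
          simp only [map_sub, map_mul, map_pow, map_natCast, map_intCast, hc] at this
          linear_combination he - this
        have h2 : π (σ e - e) = 0 := by
          by_contra h
          have hu := isUnit_of_residue π hπ hker hpn _ h
          exact hpn' j hj (by simpa using (hu.mul_left_eq_zero).mp h1)
        have h3 : π e ^ p = π e := by
          rw [map_sub, hσ, sub_eq_zero] at h2; exact h2
        obtain ⟨w, hw⟩ : ∃ w : ℤ, (w : k) = π e := by
          have h4 := (Subfield.mem_bot_iff_pow_eq_self (F := k) (p := p)).mpr h3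
          exact (mem_bot_iff_intCast p k).mp h4
        obtain ⟨y, hy⟩ := hker (e - w) (by simp [hw])
        refine ⟨z + p ^ j * w, y, ?_⟩
        push_cast
        rw [pow_succ]
        linear_combination he + (p : W) ^ j * hy
      · refine ⟨z, ?_⟩
        have : (p : W) ^ j = 0 := pow_eq_zero_of_le (not_lt.mp hj) hpn
        rw [he, this, zero_mul]; exact dvd_zero _
  obtain ⟨z, hz⟩ := key n
  rw [hpn, zero_dvd_iff, sub_eq_zero] at hz
  exact ⟨z, hz.symm⟩

lemma fixed_linInd (π : W →+* k) (hπ : Function.Surjective π) (σ : W →+* W)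
    (hσ : ∀ c, π (σ c) = π c ^ p)
    (hker : ∀ c, π c = 0 → (p : W) ∣ c) (hpn : (p : W) ^ n = 0) (hpn' : ∀ j < n, (p : W) ^ j ≠ 0)
    {M : Type*} [AddCommGroup M] [Module W M] (Φ : M →ₛₗ[σ] M) {ι : Type*} [Fintype ι]
    (e : ι → M) (he : ∀ i, Φ (e i) = e i)
    (hind : ∀ z : ι → ℤ, ∑ i, (z i : W) • e i = 0 → ∀ i, (z i : W) = 0) :
    LinearIndependent W e := by
  classical
  rw [Fintype.linearIndependent_iff]
  have key : ∀ (m : ℕ) (c : ι → W), (Finset.univ.filter fun i => c i ≠ 0).card = m →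
      ∑ i, c i • e i = 0 → ∀ i, c i = 0 := by
    intro m
    induction m using Nat.strong_induction_on with
    | _ m ih =>
      intro c hm hc
      by_contra! hcon
      obtain ⟨i0, hi0⟩ := hcon
      obtain ⟨j, u, hu, hcu⟩ := eq_pow_mul_unit π hπ hker hpn (c i0) hi0
      obtain ⟨u, rfl⟩ := hu
      -- normalised relation
      set c' : ι → W := fun i => (↑u⁻¹ : W) * c i with hc'
      have hc'0 : ∑ i, c' i • e i = 0 := by
        simp only [hc', mul_smul, ← Finset.smul_sum, hc, smul_zero]
      have hc'i0 : c' i0 = (p : W) ^ j := by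
        simp only [hc', hcu]
        rw [mul_comm, mul_assoc, Units.mul_inv, mul_one]
      have hrel : ∑ i, (σ (c' i) - c' i) • e i = 0 := by
        simp only [sub_smul, Finset.sum_sub_distrib, hc'0, sub_zero]
        have := congrArg Φ hc'0
        simpa only [map_sum, LinearMap.map_smulₛₗ, he, map_zero] using this
      have hfix : ∀ i, σ (c' i) - c' i = 0 := by
        refine ih _ ?_ _ rfl hrel
        rw [← hm]
        apply Finset.card_lt_card
        rw [Finset.ssubset_iff_of_subset]
        · exact ⟨i0, by simpa using hi0, by simp [hc'i0]⟩
        · intro i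
          simp only [Finset.mem_filter, Finset.mem_univ, true_and]
          intro h h0
          apply h
          simp [hc', h0]
      choose z hz using fun i => int_of_fixed π hπ σ hσ hker hpn hpn' (c' i) (sub_eq_zero.mp (hfix i))
      have h0 := hind z (by simpa only [hz] using hc'0) i0
      rw [hz] at h0
      exact hi0 (by simpa [hc'] using h0)
  intro c hc
  exact key _ c rfl hc

lemma exists_iterate_mem_span (π : W →+* k) (hπ : Function.Surjective π) (σ : W →+* W)
    (hσ : ∀ c, π (σ c) = π c ^ p) [IsNoetherianRing W]
    (hker : ∀ c, π c = 0 → (p : W) ∣ c) (hpn : (p : W) ^ n = 0)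
    {M : Type*} [AddCommGroup M] [Module W M] [Module.Finite W M] (Φ : M →ₛₗ[σ] M) 
    (S : Submodule W M) (hS : S = Submodule.span W {x | Φ x = x}) :
    (∀ x ∈ S, Φ x ∈ S) ∧ ∃ N, ∀ x, Φ^[N] x ∈ S := by
  have hstab : ∀ x ∈ S, Φ x ∈ S := by
    intro x hx
    rw [hS] at hx
    induction hx using Submodule.span_induction with
    | mem x hx => rw [Set.mem_ofPred_eq] at hx; rw [hx, hS]; exact Submodule.subset_span hx
    | zero => simp
    | add x y _ _ h1 h2 => rw [map_add]; exact S.add_mem h1 h2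
    | smul a x _ h => rw [LinearMap.map_smulₛₗ]; exact S.smul_mem _ h
  have hsurj : ∀ s ∈ S, ∃ s' ∈ S, Φ s' - s' = s := by
    intro x hx
    rw [hS] at hx
    suffices H : ∀ c : W, ∃ s' ∈ S, Φ s' - s' = c • x by simpa using H 1
    induction hx using Submodule.span_induction with
    | mem x hx =>
      intro c0
      rw [Set.mem_ofPred_eq] at hx
      obtain ⟨c, hc⟩ := artin_schreier π hπ σ hσ hker hpn c0
      refine ⟨c • x, S.smul_mem _ (hS ▸ Submodule.subset_span hx), ?_⟩
      rw [LinearMap.map_smulₛₗ, hx, ← sub_smul, hc]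
    | zero => intro c; exact ⟨0, S.zero_mem, by simp⟩
    | add x y _ _ h1 h2 =>
      intro c
      obtain ⟨a, ha, h1⟩ := h1 c
      obtain ⟨b, hb, h2⟩ := h2 c
      exact ⟨a + b, S.add_mem ha hb, by rw [map_add, smul_add, ← h1, ← h2]; abel⟩
    | smul a x hx h => intro c; rw [smul_smul]; exact h _
  refine ⟨hstab, ?_⟩
  let Φ' : M ⧸ S →ₛₗ[σ] M ⧸ S := S.mapQ S Φ hstab
  have hΦ' : ∀ x, Φ' (S.mkQ x) = S.mkQ (Φ x) := fun x => rfl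
  have hit : ∀ j x, Φ'^[j] (S.mkQ x) = S.mkQ (Φ^[j] x) := by
    intro j
    induction j with
    | zero => simp
    | succ j ih => intro x; rw [Function.iterate_succ_apply', ih, hΦ', Function.iterate_succ_apply']
  have hno : ∀ v, Φ' v = v → v = 0 := by
    intro v hv
    obtain ⟨x, rfl⟩ := S.mkQ_surjective v
    rw [hΦ'] at hv
    have h1 : Φ x - x ∈ S := (Submodule.Quotient.eq S).mp hv
    obtain ⟨s', hs', h2⟩ := hsurj _ h1
    have h3 : Φ (x - s') = x - s' := by
      rw [map_sub]
      have : Φ s' = s' + (Φ x - x) := by rw [← h2]; abel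
      rw [this]; abel
    have h4 : x - s' ∈ S := by rw [hS]; exact Submodule.subset_span h3
    have h5 : x ∈ S := by simpa using S.add_mem h4 hs'
    simpa using h5
  have hmono : ∀ j l x, j ≤ l → Φ^[j] x ∈ S → Φ^[l] x ∈ S := by
    intro j l x hjl h
    induction l, hjl using Nat.le_induction with
    | base => exact h
    | succ l _ ih => rw [Function.iterate_succ_apply']; exact hstab _ ih
  have hel : ∀ x, ∃ j, Φ^[j] x ∈ S := by
    intro x
    obtain ⟨j, hj⟩ := nilp_of_no_fixed π hπ σ hσ hker hpn Φ' hno (S.mkQ x)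
    rw [hit] at hj
    exact ⟨j, by simpa using hj⟩
  obtain ⟨r, s, hs⟩ := Module.Finite.exists_fin (R := W) (M := M)
  choose f hf using fun i => hel (s i)
  refine ⟨Finset.univ.sup f, fun x => ?_⟩
  have hx : x ∈ Submodule.span W (Set.range s) := by rw [hs]; trivial
  set N := Finset.univ.sup f
  have hadd : ∀ x y, Φ^[N] (x + y) = Φ^[N] x + Φ^[N] y := fun x y => iterate_map_add Φ N x y
  have hsmul : ∀ j (c : W) x, Φ^[j] (c • x) = σ^[j] c • Φ^[j] x := by
    intro j c x
    induction j with
    | zero => simp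
    | succ j ih => simp only [Function.iterate_succ_apply', ih, LinearMap.map_smulₛₗ]
  induction hx using Submodule.span_induction with
  | mem x hx =>
    obtain ⟨i, rfl⟩ := hx
    exact hmono _ _ _ (Finset.le_sup (Finset.mem_univ i)) (hf i)
  | zero => rw [iterate_map_zero]; exact S.zero_mem
  | add x y _ _ h1 h2 => rw [hadd]; exact S.add_mem h1 h2
  | smul a x _ h => rw [hsmul]; exact S.smul_mem _ h
end Abs

section Conc
variable (p d n : ℕ) [hp : Fact p.Prime]

theorem tw_frob_truncate (x : WittVector p (FqBar p d)) :
    truncatedWittFrobenius p n (FqBar p d) (WittVector.truncate n x) =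
      WittVector.truncate n (WittVector.frobenius x) := by
  apply TruncatedWittVector.ext
  intro i
  rw [truncatedWittFrobenius, TruncatedWittVector.coeff_mk, WittVector.coeff_truncate,
    WittVector.coeff_truncate, WittVector.coeff_frobenius_charP]

/-- Frobenius as a ring homomorphism. -/
noncomputable def twFrob : TruncatedWittVector p n (FqBar p d) →+* TruncatedWittVector p n (FqBar p d) where
  toFun := truncatedWittFrobenius p n (FqBar p d)
  map_one' := by
    rw [← map_one (WittVector.truncate n), tw_frob_truncate, map_one]
  map_zero' := by
    rw [← map_zero (WittVector.truncate n), tw_frob_truncate, map_zero]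
  map_add' := by
    intro x y
    obtain ⟨x, rfl⟩ := WittVector.truncate_surjective p n _ x
    obtain ⟨y, rfl⟩ := WittVector.truncate_surjective p n _ y
    rw [← map_add, tw_frob_truncate, tw_frob_truncate, tw_frob_truncate, map_add, map_add]
  map_mul' := by
    intro x y
    obtain ⟨x, rfl⟩ := WittVector.truncate_surjective p n _ x
    obtain ⟨y, rfl⟩ := WittVector.truncate_surjective p n _ y
    rw [← map_mul, tw_frob_truncate, tw_frob_truncate, tw_frob_truncate, map_mul, map_mul]

theorem tw_res_truncate (hn : 0 < n) (x : WittVector p (FqBar p d)) :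
    (WittVector.truncate n x).coeff ⟨0, hn⟩ = WittVector.constantCoeff x := by
  rw [WittVector.coeff_truncate]; rfl

/-- Residue map. -/
noncomputable def twRes (hn : 0 < n) : TruncatedWittVector p n (FqBar p d) →+* FqBar p d where
  toFun x := x.coeff ⟨0, hn⟩
  map_one' := by
    rw [← map_one (WittVector.truncate n), tw_res_truncate, map_one]
  map_zero' := by
    rw [← map_zero (WittVector.truncate n), tw_res_truncate, map_zero]
  map_add' := by
    intro x y
    obtain ⟨x, rfl⟩ := WittVector.truncate_surjective p n _ x
    obtain ⟨y, rfl⟩ := WittVector.truncate_surjective p n _ y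
    rw [← map_add, tw_res_truncate, tw_res_truncate, tw_res_truncate, map_add]
  map_mul' := by
    intro x y
    obtain ⟨x, rfl⟩ := WittVector.truncate_surjective p n _ x
    obtain ⟨y, rfl⟩ := WittVector.truncate_surjective p n _ y
    rw [← map_mul, tw_res_truncate, tw_res_truncate, tw_res_truncate, map_mul]

theorem twRes_surj (hn : 0 < n) : Function.Surjective (twRes p d n hn) := fun a =>
  ⟨TruncatedWittVector.mk p fun _ => a, by
    exact TruncatedWittVector.coeff_mk (p := p) (fun _ : Fin n => a) ⟨0, hn⟩⟩

theorem twRes_frob (hn : 0 < n) (c : TruncatedWittVector p n (FqBar p d)) :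
    twRes p d n hn (twFrob p d n c) = twRes p d n hn c ^ p := by
  change (truncatedWittFrobenius p n (FqBar p d) c).coeff _ = c.coeff _ ^ p
  rw [truncatedWittFrobenius, TruncatedWittVector.coeff_mk]

theorem twRes_ker (hn : 0 < n) (c : TruncatedWittVector p n (FqBar p d))
    (hc : twRes p d n hn c = 0) : (p : TruncatedWittVector p n (FqBar p d)) ∣ c := by
  obtain ⟨x, rfl⟩ := WittVector.truncate_surjective p n _ c
  have hx : x.coeff 0 = 0 := by
    have : (WittVector.truncate n x).coeff ⟨0, hn⟩ = 0 := hc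
    rwa [WittVector.coeff_truncate] at this
  have h1 := WittVector.verschiebung_shift x 0 (by
    intro i hi
    obtain rfl : i = 0 := by omega
    exact hx)
  obtain ⟨y, hy⟩ := (WittVector.frobenius_bijective p (FqBar p d)).2 (x.shift 1)
  have h2 : x = y * p := by
    rw [← WittVector.verschiebung_frobenius, hy]
    have h0 : x.shift 0 = x := by
      ext i
      simp [WittVector.shift_coeff]
    rw [h0] at h1
    exact h1.symm
  refine ⟨WittVector.truncate n y, ?_⟩
  rw [h2, map_mul, map_natCast, mul_comm]

theorem tw_pow_zero : (p : TruncatedWittVector p n (FqBar p d)) ^ n = 0 := by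
  have := TruncatedWittVector.p_pow_natCast_eq_zero p n (FqBar p d)
  rwa [Nat.cast_pow] at this

theorem tw_pow_ne_zero (j : ℕ) (hj : j < n) : (p : TruncatedWittVector p n (FqBar p d)) ^ j ≠ 0 := by
  intro h
  have h2 : WittVector.truncate n ((p : WittVector p (FqBar p d)) ^ j) = 0 := by
    rw [map_pow, map_natCast, h]
  have h3 := (WittVector.mem_ker_truncate n _).mp (RingHom.mem_ker.mpr h2) j hj
  rw [WittVector.coeff_p_pow] at h3
  exact one_ne_zero h3

instance tw_noeth : IsNoetherianRing (TruncatedWittVector p n (FqBar p d)) :=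
  isNoetherianRing_of_surjective (WittVector p (FqBar p d)) _ (WittVector.truncate n)
    (WittVector.truncate_surjective p n _)
end Conc

/-- The cast from `ZMod (p ^ n)` is additive. -/
theorem tw_cast_exists (p d n : ℕ) [Fact p.Prime] :
    ∃ g : ZMod (p ^ n) →+ TruncatedWittVector p n (FqBar p d), ∀ z, g z = (z.val : ℕ) := by
  haveI : NeZero (p ^ n) := ⟨pow_ne_zero _ (Fact.out : p.Prime).ne_zero⟩
  have h0 : Int.castAddHom (TruncatedWittVector p n (FqBar p d)) ((p ^ n : ℕ) : ℤ) = 0 := by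
    have := TruncatedWittVector.p_pow_natCast_eq_zero p n (FqBar p d)
    simpa using this
  refine ⟨ZMod.lift (p ^ n) ⟨Int.castAddHom _, h0⟩, fun z => ?_⟩
  have h := ZMod.lift_coe (p ^ n) ⟨Int.castAddHom (TruncatedWittVector p n (FqBar p d)), h0⟩
    (z.val : ℤ)
  have hz : (((z.val : ℕ) : ℤ) : ZMod (p ^ n)) = z := by
    rw [Int.cast_natCast, ZMod.natCast_zmod_val]
  rw [hz] at h
  rw [h]
  exact Int.cast_natCast _

theorem trace_main
    (p d n : ℕ) [Fact p.Prime] (hn : 0 < n)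
    (M : Type*) [AddCommGroup M] [Module (TruncatedWittVector p n (FqBar p d)) M]
    [Module.Finite (TruncatedWittVector p n (FqBar p d)) M]
    [Module.Free (TruncatedWittVector p n (FqBar p d)) M]
    (M0 : AddSubgroup M)
    (hspan : Submodule.span (TruncatedWittVector p n (FqBar p d)) (M0 : Set M) = ⊤)
    (Φ : M →+ M)
    (hΦ : ∀ (c : TruncatedWittVector p n (FqBar p d)) (x : M),
      Φ (c • x) = truncatedWittFrobenius p n (FqBar p d) c • Φ x)
    (hΦ0 : ∀ x ∈ M0, Φ x ∈ M0)
    (F : M →ₗ[TruncatedWittVector p n (FqBar p d)] M)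
    (hF0 : ∀ x ∈ M0, F x = (⇑Φ)^[d] x)
    [Module (ZMod (p ^ n)) Φ.fixedSubgroup]
    (hfree : Module.Free (ZMod (p ^ n)) Φ.fixedSubgroup)
    (hfin : Module.Finite (ZMod (p ^ n)) Φ.fixedSubgroup) (hd : d ≠ 0) :
    ∃ N : ℕ, 1 ≤ N ∧ ∀ m : ℕ, N ≤ m →
      ∀ φ : M →ₗ[TruncatedWittVector p n (FqBar p d)] M, (∀ x ∈ M0, φ x ∈ M0) →
        (∀ x : M, φ (Φ x) = Φ (φ x)) →
        ∀ ψ : Φ.fixedSubgroup →ₗ[ZMod (p ^ n)] Φ.fixedSubgroup,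
          (∀ x : Φ.fixedSubgroup, (ψ x : M) = φ ((F ^ m) (x : M))) →
          (((LinearMap.trace (ZMod (p ^ n)) Φ.fixedSubgroup ψ).val : ℕ) :
            (TruncatedWittVector p n (FqBar p d))) =
            LinearMap.trace (TruncatedWittVector p n (FqBar p d)) M (φ ∘ₗ F ^ m) := by
  classical
  set W := TruncatedWittVector p n (FqBar p d) with hW
  haveI : NeZero (p ^ n) := ⟨pow_ne_zero _ (Fact.out : p.Prime).ne_zero⟩
  haveI : Fact (1 < p ^ n) := ⟨Nat.one_lt_pow hn.ne' (Fact.out : p.Prime).one_lt⟩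
  let σ := twFrob p d n
  let Φ' : M →ₛₗ[σ] M := { Φ with map_smul' := hΦ }
  have hΦ' : ∀ x, Φ' x = Φ x := fun _ => rfl
  let π := twRes p d n hn
  have hπ := twRes_surj p d n hn
  have hσ := twRes_frob p d n hn
  have hker := twRes_ker p d n hn
  have hpn := tw_pow_zero p d n
  have hpn' := tw_pow_ne_zero p d n
  let b := Module.Free.chooseBasis (ZMod (p ^ n)) Φ.fixedSubgroup
  let ι := Module.Free.ChooseBasisIndex (ZMod (p ^ n)) Φ.fixedSubgroup
  let e : ι → M := fun i => (b i : M)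
  have he : ∀ i, Φ' (e i) = e i := fun i => (b i).2
  obtain ⟨g, hg⟩ := tw_cast_exists p d n
  have hgsmul : ∀ (z : ZMod (p ^ n)) (x : Φ.fixedSubgroup), ((z • x : Φ.fixedSubgroup) : M) = g z • (x : M) := by
    intro z x
    rw [hg, Nat.cast_smul_eq_nsmul]
    conv_lhs => rw [← ZMod.natCast_zmod_val z, Nat.cast_smul_eq_nsmul]
    rfl
  have hexp : ∀ x : Φ.fixedSubgroup, (x : M) = ∑ i, g (b.repr x i) • e i := by
    intro x
    conv_lhs => rw [← b.sum_repr x]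
    rw [AddSubgroup.val_finset_sum]
    exact Finset.sum_congr rfl fun i _ => hgsmul _ _
  have hgint : ∀ z : ℤ, g (z : ZMod (p ^ n)) = (z : W) := by
    have h1 : g 1 = 1 := by rw [hg, ZMod.val_one]; simp
    intro z
    have := map_zsmul g z 1
    rw [h1] at this
    simpa using this
  have hind : LinearIndependent W e := by
    refine fixed_linInd π hπ σ hσ hker hpn hpn' Φ' e he ?_
    intro z hz i
    have h1 : ∑ i, (z i : ZMod (p ^ n)) • b i = 0 := by
      apply Subtype.ext
      rw [AddSubgroup.val_finset_sum]
      simp only [hgsmul, hgint]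
      exact hz
    have h2 := Fintype.linearIndependent_iff.mp b.linearIndependent _ h1 i
    rw [← hgint, h2, map_zero]
  let S : Submodule W M := Submodule.span W (Set.range e)
  have hS : S = Submodule.span W {x | Φ' x = x} := by
    apply le_antisymm
    · apply Submodule.span_mono
      rintro _ ⟨i, rfl⟩
      exact he i
    · rw [Submodule.span_le]
      intro x hx
      have := hexp ⟨x, hx⟩
      change x = _ at this
      rw [this]
      exact Submodule.sum_mem _ fun i _ => Submodule.smul_mem _ _ (Submodule.subset_span ⟨i, rfl⟩)
  obtain ⟨hstab, N, hN⟩ := exists_iterate_mem_span π hπ σ hσ hker hpn Φ' S hS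
  have hN' : ∀ l, N ≤ l → ∀ x, Φ^[l] x ∈ S := by
    intro l hl x
    obtain ⟨r, rfl⟩ := Nat.exists_eq_add_of_le hl
    rw [Function.iterate_add_apply]
    exact hN _
  have hM0it : ∀ l, ∀ x ∈ M0, Φ^[l] x ∈ M0 := by
    intro l x hx
    induction l with
    | zero => exact hx
    | succ l ih => rw [Function.iterate_succ_apply']; exact hΦ0 _ ih
  have hFm : ∀ m, ∀ x ∈ M0, (F ^ m) x = Φ^[d * m] x := by
    intro m x hx
    induction m with
    | zero => simp
    | succ m ih =>
      rw [pow_succ', Module.End.mul_apply, ih, hF0 _ (hM0it _ x hx), ← Function.iterate_add_apply]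
      rw [Nat.mul_succ, Nat.add_comm]
  refine ⟨N + 1, by omega, fun m hm φ _ hφ ψ hψ => ?_⟩
  have hφS : ∀ x ∈ S, φ x ∈ S := by
    intro x hx
    induction hx using Submodule.span_induction with
    | mem x hx =>
      obtain ⟨i, rfl⟩ := hx
      rw [hS]
      apply Submodule.subset_span
      change Φ (φ (e i)) = φ (e i)
      rw [← hφ]
      exact congrArg φ (he i)
    | zero => simp
    | add x y _ _ h1 h2 => rw [map_add]; exact S.add_mem h1 h2
    | smul a x _ h => rw [map_smul]; exact S.smul_mem _ h
  have hFS : ∀ x, (F ^ m) x ∈ S := by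
    intro x
    have hx : x ∈ Submodule.span W (M0 : Set M) := by rw [hspan]; trivial
    induction hx using Submodule.span_induction with
    | mem x hx =>
      rw [hFm m x hx]
      refine hN' _ ?_ _
      have : 1 * m ≤ d * m := Nat.mul_le_mul_right m (Nat.one_le_iff_ne_zero.mpr hd)
      omega
    | zero => simp
    | add x y _ _ h1 h2 => rw [map_add]; exact S.add_mem h1 h2
    | smul a x _ h => rw [map_smul]; exact S.smul_mem _ h
  let G : M →ₗ[W] S := (φ ∘ₗ F ^ m).codRestrict S fun x => hφS _ (hFS x)
  let B : Module.Basis ι W S := Module.Basis.span hind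
  have hB : ∀ i, (B i : M) = e i := fun i => congrArg Subtype.val (Module.Basis.span_apply hind i)
  haveI : Module.Free W S := Module.Free.of_basis B
  haveI : Module.Finite W S := Module.Finite.of_basis B
  have htr : φ ∘ₗ F ^ m = S.subtype ∘ₗ G := rfl
  rw [htr, LinearMap.trace_comp_comm', LinearMap.trace_eq_matrix_trace W B,
    LinearMap.trace_eq_matrix_trace (ZMod (p ^ n)) b, ← hg]
  simp only [Matrix.trace, Matrix.diag_apply, LinearMap.toMatrix_apply, map_sum]
  refine Finset.sum_congr rfl fun i _ => ?_
  have h1 : (G ∘ₗ S.subtype) (B i) = ∑ j, g (b.repr (ψ (b i)) j) • B j := by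
    apply Subtype.ext
    rw [AddSubmonoidClass.coe_finset_sum]
    simp only [Submodule.coe_smul, hB]
    rw [← hexp, hψ]
    change φ ((F ^ m) (B i : M)) = _
    rw [hB]
  rw [h1, B.repr_sum_self]

/-- In the setting of base change from `W_n(𝔽_q)` to `W_n(k)` (the
`𝔽_q`-structure being encoded by the generating subgroup `M₀` of elements defined over
`W_n(𝔽_q)`, stable under `Φ` and under `σ^d`-fixed scalars, on which `F` is `Φ^d`), assume in
addition that `M` is free over `W_n(k)` and `M^{Φ=1}` is free over `ℤ/pⁿ`.  Then there exists an
integer `N ≥ 1` such that for every `W_n(k)`-linear endomorphism `φ` of `M` that is defined over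
`W_n(𝔽_q)` (i.e. preserves `M₀`) and commutes with `Φ`, and every `m ≥ N`, one has
`Tr(φ ∘ F^m | M^{Φ=1}) = Tr(φ ∘ F^m | M)`, the first trace taken over `ℤ/pⁿ` and the second
over `W_n(k)`, compared via the inclusion `ℤ/pⁿ → W_n(k)`.  (Since `φ ∘ F^m` preserves
`M^{Φ=1}`, its restriction is implemented by any `ℤ/pⁿ`-linear map `ψ` of `M^{Φ=1}` agreeing
with it.) -/
theorem trace_on_fixed_points_eq_trace
    (p d n : ℕ) [Fact p.Prime] (hd : d ≠ 0)
    (M : Type*) [AddCommGroup M] [Module (TruncatedWittVector p n (FqBar p d)) M]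
    [Module.Finite (TruncatedWittVector p n (FqBar p d)) M]
    [Module.Free (TruncatedWittVector p n (FqBar p d)) M]
    (M0 : AddSubgroup M)
    (hspan : Submodule.span (TruncatedWittVector p n (FqBar p d)) (M0 : Set M) = ⊤)
    (Φ : M →+ M)
    (hΦ : ∀ (c : TruncatedWittVector p n (FqBar p d)) (x : M),
      Φ (c • x) = truncatedWittFrobenius p n (FqBar p d) c • Φ x)
    (hΦ0 : ∀ x ∈ M0, Φ x ∈ M0)
    (hM0smul : ∀ c : TruncatedWittVector p n (FqBar p d),
      (truncatedWittFrobenius p n (FqBar p d))^[d] c = c → ∀ x ∈ M0, c • x ∈ M0)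
    (F : M →ₗ[TruncatedWittVector p n (FqBar p d)] M)
    (hF0 : ∀ x ∈ M0, F x = (⇑Φ)^[d] x) :
    letI : Module (ZMod (p ^ n)) (Φ.fixedSubgroup) := AddMonoidHom.fixedSubgroupZModModule (p ^ n) Φ (by
      intro x
      apply Subtype.ext
      show (p ^ n) • (x : M) = 0
      rw [← Nat.cast_smul_eq_nsmul (TruncatedWittVector p n (FqBar p d)), TruncatedWittVector.p_pow_natCast_eq_zero p n,
        zero_smul])
    ∀ _hfree : Module.Free (ZMod (p ^ n)) Φ.fixedSubgroup,
    ∀ _hfin : Module.Finite (ZMod (p ^ n)) Φ.fixedSubgroup,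
    ∃ N : ℕ, 1 ≤ N ∧ ∀ m : ℕ, N ≤ m →
      ∀ φ : M →ₗ[TruncatedWittVector p n (FqBar p d)] M, (∀ x ∈ M0, φ x ∈ M0) → (∀ x : M, φ (Φ x) = Φ (φ x)) →
        ∀ ψ : Φ.fixedSubgroup →ₗ[ZMod (p ^ n)] Φ.fixedSubgroup,
          (∀ x : Φ.fixedSubgroup, (ψ x : M) = φ ((F ^ m) (x : M))) →
          (((LinearMap.trace (ZMod (p ^ n)) Φ.fixedSubgroup ψ).val : ℕ) : (TruncatedWittVector p n (FqBar p d))) =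
            LinearMap.trace (TruncatedWittVector p n (FqBar p d)) M (φ ∘ₗ F ^ m) := by
  intro hfree hfin
  rcases Nat.eq_zero_or_pos n with rfl | hn
  · refine ⟨1, le_rfl, fun m _ φ _ _ ψ _ => ?_⟩
    apply TruncatedWittVector.ext
    intro i
    exact i.elim0
  letI instZ : Module (ZMod (p ^ n)) (Φ.fixedSubgroup) :=
    AddMonoidHom.fixedSubgroupZModModule (p ^ n) Φ (by
      intro x
      apply Subtype.ext
      show (p ^ n) • (x : M) = 0
      rw [← Nat.cast_smul_eq_nsmul (TruncatedWittVector p n (FqBar p d)),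
        TruncatedWittVector.p_pow_natCast_eq_zero p n, zero_smul])
  change Module.Free (ZMod (p ^ n)) Φ.fixedSubgroup at hfree
  change Module.Finite (ZMod (p ^ n)) Φ.fixedSubgroup at hfin
  exact trace_main p d n hn M M0 hspan Φ hΦ hΦ0 F hF0 hfree hfin hd
end

section
/- In the previous statement, if n = 1 (so M is a finite-dimensional k-vector space, Φ is p-semilinear, and M^{Φ=1} is an F_p-vector space), then N = 1 works: for every m ≥ 1, Tr(φ ∘ F^m | M^{Φ=1}) = Tr(φ ∘ F^m | M) in k. -/
namespace TraceCharP

open Polynomial in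
/-- The recursively defined additive polynomials `B_i`. -/
noncomputable def Bpoly {k : Type*} [Field k] (p : ℕ) (a : ℕ → k) : ℕ → k[X]
  | 0 => C (a 0) * X ^ p
  | i + 1 => Bpoly p a i ^ p + C (a (i + 1)) * X ^ p

open Polynomial in
theorem Bpoly_degree {k : Type*} [Field k] {p : ℕ} (hp : 1 < p) (a : ℕ → k) (n : ℕ)
    (h : ∃ i, i ≤ n ∧ a i ≠ 0) : p ≤ (Bpoly p a n).natDegree := by
  induction n with
  | zero =>
    obtain ⟨i, hi, ha⟩ := h
    obtain rfl : i = 0 := by omega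
    simp [Bpoly, natDegree_C_mul_X_pow p _ ha]
  | succ n ih =>
    by_cases h' : ∃ i, i ≤ n ∧ a i ≠ 0
    · have h1 := ih h'
      have h2 : (C (a (n + 1)) * X ^ p : k[X]).natDegree < (Bpoly p a n ^ p).natDegree := by
        refine (natDegree_C_mul_X_pow_le _ _).trans_lt ?_
        rw [natDegree_pow]
        nlinarith
      rw [Bpoly, natDegree_add_eq_left_of_natDegree_lt h2, natDegree_pow]
      nlinarith
    · have h0 : ∀ m, m ≤ n → Bpoly p a m = 0 := by
        intro m hm
        push Not at h'
        induction m with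
        | zero => simp [Bpoly, h' 0 (by omega)]
        | succ m ihm =>
          simp [Bpoly, ihm (by omega), h' (m+1) hm, show p ≠ 0 by omega]
      obtain ⟨i, hi, ha⟩ := h
      obtain rfl : i = n + 1 := by
        by_contra hne
        exact h' ⟨i, by omega, ha⟩
      simp [Bpoly, h0 n le_rfl, show p ≠ 0 by omega, natDegree_C_mul_X_pow p _ ha]

open Polynomial in
theorem Bpoly_dvd {k : Type*} [Field k] {p : ℕ} (hp : 1 < p) (a : ℕ → k) (n : ℕ) :
    X ^ 2 ∣ Bpoly p a n := by
  have h2 : (X ^ 2 : k[X]) ∣ X ^ p := pow_dvd_pow _ hp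
  induction n with
  | zero => exact h2.mul_left _
  | succ n ih => exact dvd_add (ih.trans (dvd_pow_self _ (by omega))) (h2.mul_left _)

open Polynomial in
theorem exists_root {k : Type*} [Field k] [IsAlgClosed k] {p : ℕ} (hp : 1 < p) (a : ℕ → k) (n : ℕ)
    (h : ∃ i, i ≤ n ∧ a i ≠ 0) : ∃ t : k, t ≠ 0 ∧ (Bpoly p a n).eval t = t := by
  obtain ⟨S, hS⟩ := Bpoly_dvd hp a n
  have hS0 : S ≠ 0 := by
    rintro rfl
    have := Bpoly_degree hp a n h
    rw [hS] at this
    simp at this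
    omega
  have hdeg : (X * S - C 1 : k[X]).natDegree ≠ 0 := by
    rw [natDegree_sub_C, natDegree_X_mul hS0]
    omega
  obtain ⟨t, ht⟩ := IsAlgClosed.exists_root (X * S - C 1 : k[X])
    (fun h0 => hdeg (natDegree_eq_of_degree_eq_some h0))
  simp only [IsRoot, eval_sub, eval_mul, eval_X, eval_C] at ht
  refine ⟨t, ?_, ?_⟩
  · rintro rfl
    simp at ht
  · rw [hS]
    simp only [eval_mul, eval_pow, eval_X]
    linear_combination t * ht

/-- A semilinear map without nonzero fixed vectors is locally nilpotent. -/
theorem locally_nilpotent {k Q : Type*} [Field k] [IsAlgClosed k] {p : ℕ} (hp : 1 < p)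
    [AddCommGroup Q] [Module k Q] [FiniteDimensional k Q] (Φ : Q →+ Q)
    (hΦ : ∀ (c : k) (x : Q), Φ (c • x) = c ^ p • Φ x)
    (hfix : ∀ x, Φ x = x → x = 0) (x : Q) : ∃ n, (⇑Φ)^[n] x = 0 := by
  classical
  let v : ℕ → Q := fun i => (⇑Φ)^[i] x
  have hv : ∀ i, Φ (v i) = v (i + 1) := fun i => (Function.iterate_succ_apply' _ _ _).symm
  let S : ℕ → Submodule k Q := fun n => Submodule.span k (Set.image v (Finset.range n : Finset ℕ))
  have hmono : Monotone S := by
    intro i j hij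
    apply Submodule.span_mono
    apply Set.image_mono
    exact_mod_cast Finset.range_mono hij
  have hex : ∃ n, v n ∈ S n := by
    obtain ⟨n, hn⟩ := (monotone_stabilizes_iff_noetherian (R := k) (M := Q)).2 inferInstance
      ⟨S, hmono⟩
    refine ⟨n, ?_⟩
    have := hn (n + 1) (by omega)
    simp only [OrderHom.coe_mk] at this
    rw [this]
    exact Submodule.subset_span ⟨n, by simp, rfl⟩
  have hn := Nat.find_spec hex
  have hmin := fun m => Nat.find_min hex (m := m)
  generalize Nat.find hex = n at hn hmin
  obtain ⟨a, ha⟩ := Submodule.mem_span_image_finset_iff_exists_fun' .. |>.1 hn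
  rcases n with _ | n
  · exact ⟨0, by simpa [v] using ha.symm⟩
  by_cases h : ∃ i, i ≤ n ∧ a i ≠ 0
  · exfalso
    obtain ⟨t, ht0, ht⟩ := exists_root hp a n h
    let b : ℕ → k := fun i => (Bpoly p a i).eval t
    have hb0 : b 0 = t ^ p * a 0 := by
      simp only [b, Bpoly, Polynomial.eval_mul, Polynomial.eval_C, Polynomial.eval_pow, Polynomial.eval_X]
      ring
    have hbs : ∀ i, b (i + 1) = b i ^ p + t ^ p * a (i + 1) := by
      intro i
      simp only [b, Bpoly, Polynomial.eval_add, Polynomial.eval_mul, Polynomial.eval_C, Polynomial.eval_pow, Polynomial.eval_X]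
      ring
    have hbn : b n = t := ht
    have hy : Φ (∑ i ∈ Finset.range (n + 1), b i • v i) = ∑ i ∈ Finset.range (n + 1), b i • v i := by
      rw [map_sum, Finset.sum_range_succ]
      simp only [hΦ, hv]
      rw [hbn, ← ha, Finset.smul_sum, Finset.sum_range_succ' _ n, Finset.sum_range_succ' _ n, hb0,
        ← add_assoc, ← Finset.sum_add_distrib]
      simp only [hbs, add_smul, mul_smul]
    have hy0 := hfix _ hy
    apply hmin n (by omega)
    rw [Finset.sum_range_succ, hbn] at hy0
    have : t • v n ∈ S n := by
      rw [← neg_eq_of_add_eq_zero_right hy0]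
      exact Submodule.neg_mem _ (Submodule.sum_mem _ fun i hi =>
        Submodule.smul_mem _ _ (Submodule.subset_span ⟨i, by simpa using hi, rfl⟩))
    exact (Submodule.smul_mem_iff _ ht0).1 this
  · push Not at h
    refine ⟨n + 1, ?_⟩
    change v (n + 1) = 0
    rw [← ha]
    exact Finset.sum_eq_zero fun i hi => by
      rw [h i (by simpa [Nat.lt_succ_iff] using hi), zero_smul]

/-- `Φ - 1` is surjective on the span of the fixed vectors. -/
theorem surj_on_span {k Q : Type*} [Field k] [IsAlgClosed k] {p : ℕ} (hp : 1 < p)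
    [AddCommGroup Q] [Module k Q] (Φ : Q →+ Q)
    (hΦ : ∀ (c : k) (x : Q), Φ (c • x) = c ^ p • Φ x) (w : Q)
    (hw : w ∈ Submodule.span k {x | Φ x = x}) :
    ∃ u ∈ Submodule.span k {x | Φ x = x}, Φ u - u = w := by
  induction hw using Submodule.closure_induction with
  | zero => exact ⟨0, zero_mem _, by simp⟩
  | add x y hx hy ihx ihy =>
    obtain ⟨u, hu, hu'⟩ := ihx
    obtain ⟨v, hv, hv'⟩ := ihy
    exact ⟨u + v, add_mem hu hv, by rw [map_add, ← hu', ← hv']; abel⟩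
  | smul_mem c x hx =>
    obtain ⟨t, ht⟩ : ∃ t : k, t ^ p - t = c := by
      open Polynomial in
      have hdeg : (X ^ p - X - C c : k[X]).natDegree ≠ 0 := by
        rw [natDegree_sub_C, FiniteField.X_pow_card_sub_X_natDegree_eq _ hp]
        omega
      obtain ⟨t, ht⟩ := IsAlgClosed.exists_root (X ^ p - X - C c : k[X])
        (fun h0 => hdeg (natDegree_eq_of_degree_eq_some h0))
      exact ⟨t, by simpa [IsRoot, sub_eq_zero] using ht⟩
    refine ⟨t • x, Submodule.smul_mem _ _ (Submodule.subset_span hx), ?_⟩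
    rw [hΦ, show Φ x = x from hx, ← sub_smul, ht]

/-- Iterates of `Φ` land in the span of the fixed vectors. -/
theorem iterate_mem_span {k M : Type*} [Field k] [IsAlgClosed k] {p : ℕ} [Fact p.Prime] [CharP k p]
    [AddCommGroup M] [Module k M] [FiniteDimensional k M] (Φ : M →+ M)
    (hΦ : ∀ (c : k) (x : M), Φ (c • x) = c ^ p • Φ x) (x : M) :
    ∃ n, (⇑Φ)^[n] x ∈ Submodule.span k {x | Φ x = x} := by
  have hp : 1 < p := (Fact.out : p.Prime).one_lt
  set W := Submodule.span k {x | Φ x = x} with hW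
  let Φs : M →ₛₗ[frobenius k p] M :=
    { toFun := Φ, map_add' := map_add Φ, map_smul' := fun c x => hΦ c x }
  have hWΦ : W ≤ W.comap Φs := by
    rw [hW, Submodule.span_le]
    intro y hy
    change Φ y ∈ W
    rw [show Φ y = y from hy]
    exact Submodule.subset_span hy
  let Ψ : (M ⧸ W) →ₛₗ[frobenius k p] (M ⧸ W) := W.mapQ W Φs hWΦ
  have hΨ : ∀ y, Ψ (W.mkQ y) = W.mkQ (Φ y) := fun y => rfl
  obtain ⟨n, hn⟩ := locally_nilpotent (k := k) hp Ψ.toAddMonoidHom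
    (fun c y => Ψ.map_smulₛₗ c y) (by
      intro y hy
      obtain ⟨y, rfl⟩ := W.mkQ_surjective y
      have h1 : W.mkQ (Φ y) = W.mkQ y := hy
      have h2 : Φ y - y ∈ W := (Submodule.Quotient.eq W).1 h1
      obtain ⟨u, hu, hu'⟩ := surj_on_span hp Φ hΦ _ h2
      have h3 : y - u ∈ W := by
        apply Submodule.subset_span
        change Φ (y - u) = y - u
        rw [map_sub, sub_eq_sub_iff_sub_eq_sub, ← hu']
      have : y ∈ W := by simpa using add_mem h3 hu
      exact (Submodule.Quotient.mk_eq_zero W).2 this) (W.mkQ x)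
  refine ⟨n, ?_⟩
  rw [← Submodule.Quotient.mk_eq_zero W]
  have h : ∀ n, W.mkQ ((⇑Φ)^[n] x) = (⇑Ψ.toAddMonoidHom)^[n] (W.mkQ x) := by
    intro n
    induction n with
    | zero => rfl
    | succ n ih =>
      rw [Function.iterate_succ_apply', Function.iterate_succ_apply', ← ih]
      rfl
  exact (h n).trans hn

open Module.Basis in
theorem trace_eq_add {k V : Type*} [Field k] [AddCommGroup V] [Module k V]
    [FiniteDimensional k V] (W : Submodule k V) (e : V →ₗ[k] V) (he : W ≤ W.comap e) :
    LinearMap.trace k V e =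
      LinearMap.trace k W (e.restrict he) + LinearMap.trace k (V ⧸ W) (W.mapQ W e he) := by
  classical
  let bW := Module.Free.chooseBasis k W
  let bQ := Module.Free.chooseBasis k (V ⧸ W)
  rw [LinearMap.trace_eq_matrix_trace k (sumQuot bW bQ), LinearMap.trace_eq_matrix_trace k bW,
    LinearMap.trace_eq_matrix_trace k bQ]
  simp only [Matrix.trace, Matrix.diag, Fintype.sum_sum_type]
  congr 1
  · refine Finset.sum_congr rfl fun i _ => ?_
    simp only [sumQuot_inl, LinearMap.toMatrix_apply]
    apply sumQuot_repr_inl_of_mem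
  · refine Finset.sum_congr rfl fun l _ => ?_
    simp only [LinearMap.toMatrix_apply, sumQuot_repr_inr]
    rw [← sumQuot_inr bW bQ l, W.mapQ_apply]
    simp

/-- Fixed vectors independent over the prime field are independent over `k`. -/
theorem indep_aux {k M ι : Type*} [Field k] {p : ℕ} [Fact p.Prime] [CharP k p]
    [AddCommGroup M] [Module k M] (Φ : M →+ M)
    (hΦ : ∀ (c : k) (x : M), Φ (c • x) = c ^ p • Φ x) (e : ι → M) (he : ∀ i, Φ (e i) = e i)
    (hind : ∀ (s : Finset ι) (c : ι → ZMod p),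
      ∑ i ∈ s, (ZMod.castHom (dvd_refl p) k (c i)) • e i = 0 → ∀ i ∈ s, c i = 0)
    (s : Finset ι) : ∀ (c : ι → k), ∑ i ∈ s, c i • e i = 0 → ∀ i ∈ s, c i = 0 := by
  classical
  induction s using Finset.induction_on with
  | empty => simp
  | insert j s hj ih =>
    intro c hc
    by_cases hcj : c j = 0
    · rw [Finset.sum_insert hj, hcj, zero_smul, zero_add] at hc
      intro i hi
      rcases Finset.mem_insert.1 hi with rfl | hi
      · exact hcj
      · exact ih c hc i hi
    · exfalso
      let c' : ι → k := fun i => (c j)⁻¹ * c i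
      have hc' : ∑ i ∈ insert j s, c' i • e i = 0 := by
        simp only [c', mul_smul]
        rw [← Finset.smul_sum, hc, smul_zero]
      have hc'j : c' j = 1 := inv_mul_cancel₀ hcj
      have hΦc : ∑ i ∈ insert j s, c' i ^ p • e i = 0 := by
        have := congrArg Φ hc'
        simpa [map_sum, hΦ, he] using this
      have hsub : ∑ i ∈ s, (c' i ^ p - c' i) • e i = 0 := by
        simp only [sub_smul, Finset.sum_sub_distrib]
        rw [Finset.sum_insert hj, hc'j] at hc' hΦc
        rw [one_pow] at hΦc
        rw [eq_neg_of_add_eq_zero_right hc', eq_neg_of_add_eq_zero_right hΦc, sub_self]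
      have h1 := ih _ hsub
      have h2 : ∀ i, ∃ z : ZMod p, i ∈ insert j s → ZMod.castHom (dvd_refl p) k z = c' i := by
        intro i
        by_cases hi : i ∈ insert j s
        · have hpow : c' i ^ p = c' i := by
            rcases Finset.mem_insert.1 hi with rfl | hi
            · rw [hc'j, one_pow]
            · exact sub_eq_zero.1 (h1 i hi)
          rw [← Subfield.mem_bot_iff_pow_eq_self k p, ← ZMod.fieldRange_castHom_eq_bot p] at hpow
          obtain ⟨z, hz⟩ := hpow
          exact ⟨z, fun _ => hz⟩
        · exact ⟨0, fun h => absurd h hi⟩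
      choose z hz using h2
      have h3 := hind (insert j s) z (by
        rw [← hc']
        exact Finset.sum_congr rfl fun i hi => by rw [hz i hi]) j (Finset.mem_insert_self _ _)
      have h4 := hz j (Finset.mem_insert_self _ _)
      rw [h3, map_zero, hc'j] at h4
      exact zero_ne_one h4

theorem main {k M : Type*} [Field k] [IsAlgClosed k] {p : ℕ} [Fact p.Prime] [CharP k p]
    (d : ℕ) (hd : d ≠ 0)
    [AddCommGroup M] [Module k M] [FiniteDimensional k M]
    (M0 : AddSubgroup M)
    (hspan : Submodule.span k (M0 : Set M) = ⊤)
    (Φ : M →+ M)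
    (hΦ : ∀ (c : k) (x : M), Φ (c • x) = c ^ p • Φ x)
    (hΦ0 : ∀ x ∈ M0, Φ x ∈ M0)
    (F : M →ₗ[k] M)
    (hF0 : ∀ x ∈ M0, F x = (⇑Φ)^[d] x)
    [Module (ZMod p) Φ.fixedSubgroup]
    [Module.Finite (ZMod p) Φ.fixedSubgroup]
    (m : ℕ) (hm : 1 ≤ m)
    (φ : M →ₗ[k] M) (hφ0 : ∀ x ∈ M0, φ x ∈ M0) (hφ : ∀ x : M, φ (Φ x) = Φ (φ x))
    (ψ : Φ.fixedSubgroup →ₗ[ZMod p] Φ.fixedSubgroup)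
    (hψ : ∀ x : Φ.fixedSubgroup, (ψ x : M) = φ ((F ^ m) (x : M))) :
    (((LinearMap.trace (ZMod p) Φ.fixedSubgroup ψ).val : ℕ) : k) =
            LinearMap.trace k M (φ ∘ₗ F ^ m) := by
  classical
  set T : M →ₗ[k] M := φ ∘ₗ F ^ m with hT
  set W := Submodule.span k {x | Φ x = x} with hW
  let σ : ZMod p →+* k := ZMod.castHom (dvd_refl p) k
  have hσ : ∀ z : ZMod p, ((z.val : ℕ) : k) = σ z := fun z => by
    simp [σ, ZMod.castHom_apply, ZMod.natCast_val]
  have hsmul : ∀ (z : ZMod p) (x : Φ.fixedSubgroup), ((z • x : Φ.fixedSubgroup) : M) =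
      σ z • (x : M) := by
    intro z x
    rw [← hσ, Nat.cast_smul_eq_nsmul]
    conv_lhs => rw [← ZMod.natCast_zmod_val z, Nat.cast_smul_eq_nsmul]
    rfl
  let b := Module.Free.chooseBasis (ZMod p) Φ.fixedSubgroup
  let e := fun i => (b i : M)
  have he : ∀ i, Φ (e i) = e i := fun i => (b i).2
  have hli : LinearIndependent k e := by
    rw [linearIndependent_iff']
    refine fun s c hc i hi => indep_aux Φ hΦ e he ?_ s c hc i hi
    intro s c hc
    refine linearIndependent_iff'.1 b.linearIndependent s c ?_
    apply Subtype.ext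
    rw [AddSubgroup.val_finsetSum]
    simp only [hsmul]
    exact hc
  have hrange : Submodule.span k (Set.range e) = W := by
    apply le_antisymm
    · apply Submodule.span_mono
      rintro _ ⟨i, rfl⟩
      exact he i
    · rw [hW, Submodule.span_le]
      intro x hx
      have h := b.sum_repr ⟨x, hx⟩
      have h2 := congrArg (Subtype.val) h
      rw [AddSubgroup.val_finsetSum] at h2
      simp only [hsmul] at h2
      rw [← h2]
      exact Submodule.sum_mem _ fun i _ => Submodule.smul_mem _ _ (Submodule.subset_span ⟨i, rfl⟩)
  -- everything commutes on `M`
  have hext : ∀ f g : M →ₗ[k] M, (∀ x ∈ M0, f x = g x) → f = g := by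
    intro f g hfg
    exact LinearMap.ext_on hspan hfg
  have hΦit0 : ∀ n, ∀ x ∈ M0, (⇑Φ)^[n] x ∈ M0 := by
    intro n
    induction n with
    | zero => exact fun x hx => hx
    | succ n ih => exact fun x hx => ih _ (hΦ0 x hx)
  have hcomm : Commute φ F := by
    apply hext
    intro x hx
    simp only [Module.End.mul_apply]
    rw [hF0 x hx, hF0 _ (hφ0 x hx)]
    exact (Function.Commute.iterate_right (f := φ) (g := Φ) hφ d) x
  have hFn : ∀ n, ∀ x ∈ M0, (F ^ n) x = (⇑Φ)^[d * n] x := by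
    intro n
    induction n with
    | zero => intro x hx; simp
    | succ n ih =>
      intro x hx
      rw [pow_succ, Module.End.mul_apply, hF0 x hx, ih _ (hΦit0 d x hx), mul_add, mul_one,
        Function.iterate_add_apply]
  have hTW : W ≤ W.comap T := by
    rw [hW, Submodule.span_le]
    intro y hy
    have := hψ ⟨y, hy⟩
    change φ ((F ^ m) y) ∈ W
    rw [← this]
    exact Submodule.subset_span (ψ ⟨y, hy⟩).2
  have hφW : W ≤ W.comap φ := by
    rw [hW, Submodule.span_le]
    intro y hy
    apply Submodule.subset_span
    change Φ (φ y) = φ y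
    rw [← hφ, show Φ y = y from hy]
  have hφWn : ∀ n, ∀ x ∈ W, (φ ^ n) x ∈ W := by
    intro n
    induction n with
    | zero => exact fun x hx => hx
    | succ n ih =>
      intro x hx
      rw [pow_succ, Module.End.mul_apply]
      exact ih _ (hφW hx)
  have hΦW : ∀ x ∈ W, Φ x ∈ W := by
    intro x hx
    induction hx using Submodule.span_induction with
    | mem x h => rw [show Φ x = x from h]; exact Submodule.subset_span h
    | zero => simp
    | add x y _ _ hx hy => rw [map_add]; exact add_mem hx hy
    | smul c x _ hx => rw [hΦ]; exact Submodule.smul_mem _ _ hx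
  have hΦWn : ∀ n, ∀ x ∈ W, (⇑Φ)^[n] x ∈ W := by
    intro n
    induction n with
    | zero => exact fun x hx => hx
    | succ n ih => exact fun x hx => ih _ (hΦW x hx)
  have hTn : ∀ n, T ^ n = φ ^ n * F ^ (m * n) := by
    intro n
    have : T = φ * F ^ m := rfl
    rw [this, (hcomm.pow_right m).mul_pow, pow_mul]
  have hmapQ : ∀ n x, ((W.mapQ W T hTW) ^ n) (W.mkQ x) = W.mkQ ((T ^ n) x) := by
    intro n x
    induction n with
    | zero => rfl
    | succ n ih =>
      rw [pow_succ', Module.End.mul_apply, ih, pow_succ', Module.End.mul_apply]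
      rfl
  have hTWn : ∀ n, ∀ x ∈ W, (T ^ n) x ∈ W := by
    intro n
    induction n with
    | zero => exact fun x hx => hx
    | succ n ih =>
      intro x hx
      rw [pow_succ, Module.End.mul_apply]
      exact ih _ (hTW hx)
  have hloc : ∀ x : M, ∃ n, (T ^ n) x ∈ W := by
    intro x
    have hx : x ∈ Submodule.span k (M0 : Set M) := by rw [hspan]; trivial
    induction hx using Submodule.span_induction with
    | mem x h =>
      obtain ⟨n, hn⟩ := iterate_mem_span Φ hΦ x
      refine ⟨n, ?_⟩
      rw [hTn, Module.End.mul_apply]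
      apply hφWn
      rw [hFn _ x h]
      have hle : n ≤ d * (m * n) := by
        have : 1 ≤ d * m := Nat.mul_pos (Nat.pos_of_ne_zero hd) hm
        nlinarith
      obtain ⟨r, hr⟩ := Nat.exists_eq_add_of_le' hle
      rw [hr, Function.iterate_add_apply]
      exact hΦWn _ _ hn
    | zero => exact ⟨0, by simp⟩
    | add x y _ _ hx hy =>
      obtain ⟨n, hn⟩ := hx
      obtain ⟨l, hl⟩ := hy
      refine ⟨n + l, ?_⟩
      rw [map_add]
      refine add_mem ?_ ?_
      · rw [add_comm, pow_add, Module.End.mul_apply]; exact hTWn _ _ hn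
      · rw [pow_add, Module.End.mul_apply]; exact hTWn _ _ hl
    | smul c x _ hx =>
      obtain ⟨n, hn⟩ := hx
      exact ⟨n, by rw [map_smul]; exact Submodule.smul_mem _ _ hn⟩
  have hnil : IsNilpotent (W.mapQ W T hTW) := by
    rw [Module.End.isNilpotent_iff_of_finite]
    intro y
    obtain ⟨x, rfl⟩ := W.mkQ_surjective y
    obtain ⟨n, hn⟩ := hloc x
    exact ⟨n, by rw [hmapQ]; exact (Submodule.Quotient.mk_eq_zero W).2 hn⟩
  rw [trace_eq_add W T hTW, (LinearMap.isNilpotent_trace_of_isNilpotent hnil).eq_zero, add_zero, hσ]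
  let bW : Module.Basis _ k W := (Module.Basis.span hli).map (LinearEquiv.ofEq _ _ hrange)
  have hbW : ∀ i, (bW i : M) = e i := by
    intro i
    simp [bW, Module.Basis.span_apply]
  rw [LinearMap.trace_eq_matrix_trace k bW, LinearMap.trace_eq_matrix_trace (ZMod p) b]
  simp only [Matrix.trace, Matrix.diag, map_sum, LinearMap.toMatrix_apply]
  refine Finset.sum_congr rfl fun j _ => ?_
  have key : (T.restrict hTW) (bW j) = ∑ i, σ (b.repr (ψ (b j)) i) • bW i := by
    apply Subtype.ext
    rw [AddSubmonoidClass.coe_finsetSum]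
    simp only [SetLike.val_smul, hbW]
    have h := congrArg Subtype.val (b.sum_repr (ψ (b j)))
    rw [AddSubgroup.val_finsetSum] at h
    simp only [hsmul] at h
    rw [h, hψ, LinearMap.coe_restrict_apply, hbW]
    rfl
  rw [key, Module.Basis.repr_sum_self]

end TraceCharP

/-- The case `n = 1` of the trace comparison: `M` is a finite-dimensional
vector space over `k` (an algebraic closure of `𝔽_q`, `q = p ^ d`), `Φ` is a `p`-semilinear
endomorphism defined over `𝔽_q` (the `𝔽_q`-structure being encoded by the generating subgroup
`M₀`, stable under `Φ` and under `q`-power-fixed scalars, on which the `k`-linear `F` is `Φ^d`),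
and `M^{Φ=1}` is an `𝔽_p`-vector space.  Then `N = 1` works: for every `k`-linear `φ` defined
over `𝔽_q` and commuting with `Φ`, and every `m ≥ 1`,
`Tr(φ ∘ F^m | M^{Φ=1}) = Tr(φ ∘ F^m | M)` in `k`. -/
theorem trace_on_fixed_points_eq_trace_char_p
    (p d : ℕ) [Fact p.Prime] (hd : d ≠ 0)
    (M : Type*) [AddCommGroup M] [Module (FqBar p d) M] [FiniteDimensional (FqBar p d) M]
    (M0 : AddSubgroup M)
    (hspan : Submodule.span (FqBar p d) (M0 : Set M) = ⊤)
    (Φ : M →+ M)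
    (hΦ : ∀ (c : FqBar p d) (x : M), Φ (c • x) = c ^ p • Φ x)
    (hΦ0 : ∀ x ∈ M0, Φ x ∈ M0)
    (hM0smul : ∀ c : FqBar p d, c ^ p ^ d = c → ∀ x ∈ M0, c • x ∈ M0)
    (F : M →ₗ[FqBar p d] M)
    (hF0 : ∀ x ∈ M0, F x = (⇑Φ)^[d] x) :
    letI : Module (ZMod p) Φ.fixedSubgroup :=
      AddMonoidHom.fixedSubgroupZModModule p Φ (by
        intro x
        apply Subtype.ext
        show p • (x : M) = 0
        rw [← Nat.cast_smul_eq_nsmul (FqBar p d), CharP.cast_eq_zero, zero_smul])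
    ∀ _hfin : Module.Finite (ZMod p) Φ.fixedSubgroup,
    ∀ m : ℕ, 1 ≤ m →
      ∀ φ : M →ₗ[FqBar p d] M, (∀ x ∈ M0, φ x ∈ M0) → (∀ x : M, φ (Φ x) = Φ (φ x)) →
        ∀ ψ : Φ.fixedSubgroup →ₗ[ZMod p] Φ.fixedSubgroup,
          (∀ x : Φ.fixedSubgroup, (ψ x : M) = φ ((F ^ m) (x : M))) →
          (((LinearMap.trace (ZMod p) Φ.fixedSubgroup ψ).val : ℕ) : FqBar p d) =
            LinearMap.trace (FqBar p d) M (φ ∘ₗ F ^ m) := by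
  intro hfin m hm φ hφ0 hφ ψ hψ
  exact @TraceCharP.main (FqBar p d) M _ _ p _ _ d hd _ _ _ M0 hspan Φ hΦ hΦ0 F hF0
    (AddMonoidHom.fixedSubgroupZModModule p Φ _) hfin
    m hm φ hφ0 hφ ψ hψ
end
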